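/- arXiv:1203.2659 — 2 statements merged into one kernel-verified Lean document; each statement's English description precedes it below -/
import Mathlib

section
/- Let λ₁, …, λ_k be nonzero integers whose greatest common divisor is 1, and set M = |λ₁| + … + |λ_k|. For every ε > 0 there exist α > 0 and N such that for every prime p and every set A ⊆ ℤ/pℤ with N ≤ |A| ≤ α·p, one has |λ₁·A + λ₂·A + … + λ_k·A| ≥ (M − ε)·|A|. -/
open Pointwise

/-- The `n`-fold sumset `D + ⋯ + D`. -/
def iteratedSumset {G : Type*} [AddCommGroup G] [DecidableEq G] (D : Finset G) : ℕ → Finset G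
  | 0 => {0}
  | n + 1 => iteratedSumset D n + D

section Growth

variable {G : Type*} [AddCommGroup G] [DecidableEq G]

lemma iteratedSumset_add (D : Finset G) (m n : ℕ) :
    iteratedSumset D (m + n) = iteratedSumset D m + iteratedSumset D n := by
  induction n with
  | zero => exact (add_zero _).symm
  | succ n ih => rw [← add_assoc, iteratedSumset, ih, iteratedSumset, add_assoc]

lemma iteratedSumset_mono_left {D E : Finset G} (h : D ⊆ E) (n : ℕ) :
    iteratedSumset D n ⊆ iteratedSumset E n := by
  induction n with
  | zero => rfl
  | succ n ih => exact Finset.add_subset_add ih h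

lemma zero_mem_iteratedSumset {D : Finset G} (h : 0 ∈ D) (n : ℕ) : 0 ∈ iteratedSumset D n := by
  induction n with
  | zero => simp [iteratedSumset]
  | succ n ih => exact Finset.mem_add.2 ⟨0, ih, 0, h, by simp⟩

lemma iteratedSumset_mono {D : Finset G} (h : 0 ∈ D) : Monotone (iteratedSumset D) :=
  monotone_nat_of_le_succ fun _ x hx => Finset.mem_add.2 ⟨x, hx, 0, h, by simp⟩

lemma card_iteratedSumset_le (F : Finset G) (n : ℕ) :
    (iteratedSumset F n).card ≤ (n + 1) ^ F.card := by
  have key : ∀ n, iteratedSumset F n ⊆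
      (Fintype.piFinset fun _ : F => Finset.range (n + 1)).image
        fun f => ∑ x : F, f x • (x : G) := by
    intro n
    induction n with
    | zero =>
      intro x hx
      rw [iteratedSumset, Finset.mem_singleton] at hx
      exact Finset.mem_image.2 ⟨fun _ => 0, by simp, by simp [hx]⟩
    | succ n ih =>
      intro x hx
      obtain ⟨y, hy, z, hz, rfl⟩ := Finset.mem_add.1 hx
      obtain ⟨f, hf, rfl⟩ := Finset.mem_image.1 (ih hy)
      refine Finset.mem_image.2 ⟨f + Pi.single ⟨z, hz⟩ 1, ?_, ?_⟩
      · simp only [Fintype.mem_piFinset, Finset.mem_range] at hf ⊢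
        intro a
        have h1 := hf a
        have h2 : (Pi.single ⟨z, hz⟩ 1 : F → ℕ) a ≤ 1 := by
          rw [Pi.single_apply]; split_ifs <;> simp
        simp only [Pi.add_apply]
        omega
      · simp only [Pi.add_apply, add_smul, Finset.sum_add_distrib]
        congr 1
        rw [Finset.sum_eq_single ⟨z, hz⟩] <;> simp +contextual
  refine (Finset.card_le_card (key n)).trans (Finset.card_image_le.trans ?_)
  simp

/-- Sets with small difference set have polynomial growth. -/
lemma card_iteratedSumset_sub_le {K : ℕ} {A : Finset G} (hA : A.Nonempty)
    (hK : (A - A).card ≤ K * A.card) (n : ℕ) :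
    (iteratedSumset (A - A) n).card ≤ K * (n + 1) ^ K ^ 5 * A.card := by
  have hA0 : 0 < A.card := hA.card_pos
  have h0 : (0 : G) ∈ A - A := by
    obtain ⟨a, ha⟩ := hA
    exact Finset.mem_sub.2 ⟨a, ha, a, ha, sub_self a⟩
  have hP := Finset.pluennecke_ruzsa_inequality_nsmul_sub_nsmul_sub hA A 3 2
  rw [succ_nsmul, two_nsmul] at hP
  have hset : (A - A) + (A - A) + A ⊆ A + A + A - (A + A) := by
    intro x hx
    simp only [Finset.mem_add, Finset.mem_sub] at hx
    obtain ⟨_, ⟨_, ⟨a, ha, b, hb, rfl⟩, _, ⟨c, hc, d, hd, rfl⟩, rfl⟩, e, he, rfl⟩ := hx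
    exact Finset.mem_sub.2 ⟨a + c + e, Finset.add_mem_add (Finset.add_mem_add ha hc) he,
      b + d, Finset.add_mem_add hb hd, by abel⟩
  have hK' : (((A - A).card : ℚ≥0) / A.card) ≤ K := by
    rw [div_le_iff₀ (by exact_mod_cast hA0)]
    exact_mod_cast hK
  have hcard : ((A - A) + (A - A) + A).card ≤ K ^ 5 * A.card := by
    have h1 : (((A - A) + (A - A) + A).card : ℚ≥0) ≤ (K : ℚ≥0) ^ 5 * A.card := by
      refine (Nat.cast_le.2 (Finset.card_le_card hset)).trans (hP.trans ?_)
      gcongr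
    exact_mod_cast h1
  obtain ⟨F, -, hF, hcov⟩ := Finset.ruzsa_covering_add (K := (K ^ 5 : ℕ)) hA
    (by exact_mod_cast hcard)
  have hF' : F.card ≤ K ^ 5 := by exact_mod_cast hF
  have hsub : ∀ n, iteratedSumset (A - A) n ⊆ iteratedSumset F n + (A - A) := by
    intro n
    induction n with
    | zero =>
      exact Finset.singleton_subset_iff.2
        (Finset.mem_add.2 ⟨0, Finset.mem_singleton_self _, 0, h0, add_zero 0⟩)
    | succ n ih =>
      calc iteratedSumset (A - A) n + (A - A)
          ⊆ iteratedSumset F n + (A - A) + (A - A) := Finset.add_subset_add_right ih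
        _ ⊆ iteratedSumset F n + (F + (A - A)) := by
            rw [add_assoc]; exact Finset.add_subset_add_left hcov
        _ = _ := by rw [← add_assoc]; rfl
  calc _ ≤ _ := Finset.card_le_card (hsub n)
    _ ≤ (iteratedSumset F n).card * (A - A).card := Finset.card_add_le
    _ ≤ (n + 1) ^ K ^ 5 * (K * A.card) := by
        gcongr
        exact (card_iteratedSumset_le F n).trans (Nat.pow_le_pow_right (by omega) hF')
    _ = _ := by ring

end Growth

section Fibres

variable {G H : Type*} [AddCommGroup G] [DecidableEq G] [AddCommGroup H] [DecidableEq H]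

lemma Finset.mem_sum_iff_exists {ι : Type*} [DecidableEq ι] {I : Finset ι} {S : ι → Finset G}
    {x : G} : x ∈ ∑ i ∈ I, S i ↔ ∃ f : ι → G, (∀ i ∈ I, f i ∈ S i) ∧ ∑ i ∈ I, f i = x := by
  rw [← Finset.mem_coe, Finset.coe_sum, Set.mem_finsetSum]
  constructor
  · rintro ⟨f, hf, rfl⟩
    exact ⟨f, fun i hi => hf hi, rfl⟩
  · rintro ⟨f, hf, rfl⟩
    exact ⟨f, fun {i} hi => hf i hi, rfl⟩

/-- If `Y` lies in one fibre of `φ`, translates of `Y` by elements of distinct fibres are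
disjoint. -/
lemma card_image_mul_card_le_of_fibre (φ : G →+ H) (X Y : Finset G) {c : H}
    (hY : ∀ y ∈ Y, φ y = c) : (X.image φ).card * Y.card ≤ (X + Y).card := by
  have hsec : ∀ h : X.image φ, ∃ x ∈ X, φ x = h := fun h => Finset.mem_image.1 h.2
  choose σ hσ hφσ using hsec
  rw [← Finset.card_attach, ← Finset.card_product]
  refine Finset.card_le_card_of_injOn (fun q => σ q.1 + q.2) ?_ ?_
  · rintro ⟨h, y⟩ hq
    exact Finset.add_mem_add (hσ h) (Finset.mem_product.1 hq).2
  · rintro ⟨h, y⟩ hq ⟨h', y'⟩ hq' heq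
    have hy := hY y (Finset.mem_product.1 hq).2
    have hy' := hY y' (Finset.mem_product.1 hq').2
    have heq' : σ h + y = σ h' + y' := heq
    have h1 := congrArg φ heq'
    rw [map_add, map_add, hφσ, hφσ, hy, hy', add_left_inj] at h1
    obtain rfl : h = h' := Subtype.ext h1
    simpa using heq'

lemma card_image_mul_card_le (φ : G →+ H) (X Y : Finset G) :
    (X.image φ).card * Y.card ≤ (Y.image φ).card * (X + Y).card := by
  rw [Finset.card_eq_sum_card_image φ Y, Finset.mul_sum]
  refine Finset.sum_le_card_nsmul _ _ _ fun c _ => ?_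
  refine (card_image_mul_card_le_of_fibre φ X (Y.filter fun y => φ y = c) (c := c)
    fun y hy => (Finset.mem_filter.1 hy).2).trans ?_
  exact Finset.card_le_card (Finset.add_subset_add_left (Finset.filter_subset _ _))

lemma card_le_card_sum_dilates_of_subgroup {ι : Type*} [DecidableEq ι] (l : ι → ℤ) (I : Finset ι) :
    ∀ (S : AddSubgroup G) (R : Finset G), (∀ x ∈ S, (∀ i ∈ I, l i • x = 0) → x = 0) →
      (∀ x ∈ R, ∀ y ∈ R, x - y ∈ S) → R.card ≤ (∑ i ∈ I, R.image fun x => l i • x).card := by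
  classical
  induction I using Finset.induction_on with
  | empty =>
    intro S R hS hR
    rw [Finset.sum_empty, Finset.card_zero, Finset.card_le_one]
    intro x hx y hy
    exact sub_eq_zero.1 (hS _ (hR x hx y hy) (by simp))
  | insert i I hi ih =>
    intro S R hS hR
    let T : AddSubgroup G :=
      { carrier := {x | x ∈ S ∧ ∃ n : ℕ, l i ^ n • x = 0}
        zero_mem' := ⟨S.zero_mem, 0, by simp⟩
        add_mem' := by
          rintro x y ⟨hx, n, hn⟩ ⟨hy, m, hm⟩
          refine ⟨S.add_mem hx hy, n + m, ?_⟩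
          rw [smul_add, pow_add, mul_smul, mul_smul, hm, smul_comm, hn]
          simp
        neg_mem' := by
          rintro x ⟨hx, n, hn⟩
          exact ⟨S.neg_mem hx, n, by rw [smul_neg, hn, neg_zero]⟩ }
    have hT : ∀ x ∈ T, (∀ j ∈ I, l j • x = 0) → x = 0 := by
      rintro x ⟨hx, n, hn⟩ hI
      induction n with
      | zero => simpa using hn
      | succ n ihn =>
        refine ihn (hS _ (S.zsmul_mem hx _) fun j hj => ?_)
        rcases Finset.mem_insert.1 hj with rfl | hj
        · rw [← mul_smul, ← pow_succ', hn]
        · rw [smul_comm, hI j hj, smul_zero]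
    let φ := QuotientAddGroup.mk' T
    have hφ : ∀ x y, φ x = φ y ↔ x - y ∈ T := by
      intro x y
      rw [← sub_eq_zero, ← map_sub]
      exact QuotientAddGroup.eq_zero_iff _
    rcases R.eq_empty_or_nonempty with rfl | hRne
    · simp
    obtain ⟨c, hc, hmax⟩ := Finset.exists_max_image (R.image φ)
      (fun c => (R.filter fun y => φ y = c).card) (hRne.image φ)
    set F := R.filter fun y => φ y = c with hFdef
    have hRF : R.card ≤ (R.image φ).card * F.card := by
      rw [Finset.card_eq_sum_card_image φ R]
      exact Finset.sum_le_card_nsmul _ _ _ hmax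
    have hF : F.card ≤ (∑ j ∈ I, F.image fun x => l j • x).card := by
      refine ih T F hT fun x hx y hy => ?_
      rw [← hφ, (Finset.mem_filter.1 hx).2, (Finset.mem_filter.1 hy).2]
    have hfib : ∀ y ∈ ∑ j ∈ I, F.image (fun x => l j • x), φ y = ∑ j ∈ I, l j • c := by
      intro y hy
      obtain ⟨f, hf, rfl⟩ := Finset.mem_sum_iff_exists.1 hy
      rw [map_sum]
      refine Finset.sum_congr rfl fun j hj => ?_
      obtain ⟨x, hx, hxf⟩ := Finset.mem_image.1 (hf j hj)
      rw [← hxf, map_zsmul, (Finset.mem_filter.1 hx).2]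
    have hdil : (R.image φ).card ≤ ((R.image fun x => l i • x).image φ).card := by
      have himg : (R.image fun x => l i • x).image φ = (R.image φ).image fun z => l i • z := by
        rw [Finset.image_image, Finset.image_image]
        refine Finset.image_congr fun x _ => ?_
        simp
      rw [himg]
      refine (Finset.card_image_of_injOn (s := R.image φ) (f := fun z => l i • z) ?_).ge
      intro a ha b hb hab
      obtain ⟨x, hx, rfl⟩ := Finset.mem_image.1 (Finset.mem_coe.1 ha)
      obtain ⟨y, hy, rfl⟩ := Finset.mem_image.1 (Finset.mem_coe.1 hb)
      have hab' : φ (l i • x) = φ (l i • y) := by rw [map_zsmul, map_zsmul]; exact hab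
      rw [hφ] at hab' ⊢
      obtain ⟨-, n, hn⟩ := hab'
      exact ⟨hR x hx y hy, n + 1, by rw [pow_succ, mul_smul, smul_sub]; exact hn⟩
    rw [Finset.sum_insert hi]
    calc R.card ≤ (R.image φ).card * F.card := hRF
      _ ≤ _ := Nat.mul_le_mul hdil hF
      _ ≤ _ := card_image_mul_card_le_of_fibre φ _ _ hfib
      _ ≤ _ := by
        refine Finset.card_le_card (Finset.add_subset_add_left fun x hx => ?_)
        obtain ⟨f, hf, rfl⟩ := Finset.mem_sum_iff_exists.1 hx
        exact Finset.mem_sum_iff_exists.2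
          ⟨f, fun j hj => Finset.image_subset_image (Finset.filter_subset _ _) (hf j hj), rfl⟩

/-- Coprime dilates of a finite set in an abelian group have a sumset at least as large as it. -/
lemma card_le_card_sum_dilates {k : ℕ} (l : Fin k → ℤ) (hgcd : Finset.univ.gcd l = 1)
    (R : Finset G) : R.card ≤ (∑ i, R.image fun x => l i • x).card := by
  refine card_le_card_sum_dilates_of_subgroup l Finset.univ ⊤ R (fun x _ hx => ?_) (by simp)
  have h : ((addOrderOf x : ℕ) : ℤ) ∣ Finset.univ.gcd l :=
    Finset.dvd_gcd fun i hi => addOrderOf_dvd_iff_zsmul_eq_zero.2 (hx i hi)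
  rw [hgcd] at h
  have := addOrderOf_dvd_iff_zsmul_eq_zero.1 h
  simpa using this

end Fibres

section FullResidues

lemma sum_card_le_card_sum_add_card {ι : Type*} [DecidableEq ι] (I : Finset ι)
    (X : ι → Finset ℤ) (hX : ∀ i ∈ I, (X i).Nonempty) :
    (∑ i ∈ I, X i).Nonempty ∧ ∑ i ∈ I, (X i).card ≤ (∑ i ∈ I, X i).card + I.card := by
  induction I using Finset.induction_on with
  | empty => simp
  | insert i I hi ih =>
    obtain ⟨hne, hle⟩ := ih fun j hj => hX j (Finset.mem_insert_of_mem hj)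
    have hXi := hX i (Finset.mem_insert_self i I)
    rw [Finset.sum_insert hi, Finset.sum_insert hi, Finset.card_insert_of_notMem hi]
    refine ⟨hXi.add hne, ?_⟩
    have := cauchy_davenport_add_of_linearOrder_isCancelAdd hXi hne
    omega

lemma card_fibre_mul_card_image {G H : Type*} [AddCommGroup G] [Fintype G] [AddCommGroup H]
    [DecidableEq H] (f : G →+ H) (c : H) (hc : c ∈ Finset.univ.image f) :
    (Finset.univ.filter fun x => f x = c).card * (Finset.univ.image f).card = Fintype.card G := by
  have hr : ∀ d ∈ Finset.univ.image f, d ∈ Set.range f := by simp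
  rw [← Finset.card_univ, Finset.card_eq_sum_card_image f Finset.univ, mul_comm, ← smul_eq_mul,
    ← Finset.sum_const]
  exact Finset.sum_congr rfl fun d hd =>
    AddMonoidHom.card_fiber_eq_of_mem_range f (hr c hc) (hr d hd)

/-- If each `B i` meets every residue class modulo `Q`, the sum of the coprime dilates `l i • B i`
has nearly the size predicted by the one-dimensional Brunn-Minkowski inequality. -/
lemma sum_abs_mul_card_le_of_full {k : ℕ} (l : Fin k → ℤ) (hgcd : Finset.univ.gcd l = 1)
    (Q : ℕ) [NeZero Q] (hQ : ∀ i, l i ∣ Q) (B : Fin k → Finset ℤ)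
    (hB : ∀ i (u : ZMod Q), ∃ b ∈ B i, (b : ZMod Q) = u) :
    ∑ i, (l i).natAbs * (B i).card ≤ (∑ i, (B i).image fun b => l i • b).card + k * Q := by
  classical
  set S := ∑ i, (B i).image fun b => l i • b with hS
  have hQ0 : 0 < Q := NeZero.pos Q
  have hinj : ∀ i, Function.Injective fun b : ℤ => l i • b := fun i =>
    smul_right_injective ℤ fun h => hQ0.ne' (by simpa [h] using hQ i)
  let ψ : (Fin k → ZMod Q) →+ ZMod Q :=
    { toFun := fun u => ∑ i, l i • u i
      map_zero' := by simp
      map_add' := fun u v => by simp [Finset.sum_add_distrib] }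
  let χ : Fin k → (Fin k → ZMod Q) →+ ZMod Q := fun i =>
    { toFun := fun u => l i • u i
      map_zero' := by simp
      map_add' := fun u v => by simp }
  have hψ : Finset.univ.image ψ = Finset.univ := by
    obtain ⟨c, hc⟩ := Finset.gcd_eq_sum_mul Finset.univ l
    rw [Finset.eq_univ_iff_forall]
    intro s
    refine Finset.mem_image.2 ⟨fun i => (c i : ZMod Q) * s, Finset.mem_univ _, ?_⟩
    have h1 : ((∑ i, l i * c i : ℤ) : ZMod Q) = 1 := by rw [← hc, hgcd]; simp
    change ∑ i, l i • ((c i : ZMod Q) * s) = s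
    simp only [zsmul_eq_mul, ← mul_assoc, ← Finset.sum_mul]
    push_cast at h1
    rw [h1, one_mul]
  have hχ : ∀ i, (Finset.univ.image (χ i)).card * (l i).natAbs ≤ Q := by
    intro i
    have hdvd : (l i).natAbs ∣ Q := Int.natAbs_dvd_natAbs.2 (hQ i)
    obtain ⟨q, hq⟩ := hdvd
    have hl0 : 0 < (l i).natAbs := Nat.pos_of_ne_zero fun h => by simp [h] at hq; omega
    have hq0 : 0 < q := Nat.pos_of_ne_zero fun h => by simp [h] at hq; omega
    have hord : addOrderOf ((l i : ℤ) : ZMod Q) ≤ q := by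
      refine Nat.le_of_dvd hq0 (addOrderOf_dvd_of_nsmul_eq_zero ?_)
      rw [nsmul_eq_mul]
      have : ((q * l i : ℤ) : ZMod Q) = 0 := by
        rw [ZMod.intCast_zmod_eq_zero_iff_dvd]
        refine Int.natAbs_dvd_natAbs.1 ?_
        rw [Int.natAbs_mul, Int.natAbs_natCast, Int.natAbs_natCast, mul_comm, ← hq]
      exact_mod_cast this
    have hsub : (Finset.univ.image (χ i) : Set (ZMod Q)) ⊆
        AddSubgroup.zmultiples ((l i : ℤ) : ZMod Q) := by
      intro x hx
      obtain ⟨u, -, rfl⟩ := Finset.mem_image.1 (Finset.mem_coe.1 hx)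
      refine AddSubgroup.mem_zmultiples_iff.2 ⟨((u i).val : ℤ), ?_⟩
      change _ = l i • u i
      simp [mul_comm]
    have h2 : (Finset.univ.image (χ i)).card ≤ q := by
      rw [← Nat.card_zmultiples] at hord
      refine le_trans ?_ hord
      rw [← Set.ncard_coe_finset]
      exact Set.ncard_le_ncard hsub (Set.toFinite _)
    calc _ ≤ q * (l i).natAbs := Nat.mul_le_mul_right _ h2
      _ = Q := by rw [hq, mul_comm]
  have hcardG : Fintype.card (Fin k → ZMod Q) = Q ^ k := by simp
  have hmain : ∀ u : Fin k → ZMod Q,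
      ∑ i, ((B i).filter fun b : ℤ => χ i u = l i • (b : ZMod Q)).card ≤
        (S.filter fun x : ℤ => ψ u = (x : ZMod Q)).card + k := by
    intro u
    have hne : ∀ i, (((B i).filter fun b : ℤ => χ i u = l i • (b : ZMod Q)).image
        fun b => l i • b).Nonempty := by
      intro i
      obtain ⟨b, hb, hbu⟩ := hB i (u i)
      exact ⟨_, Finset.mem_image_of_mem _ (Finset.mem_filter.2 ⟨hb, by rw [hbu]; rfl⟩)⟩
    have hCD := (sum_card_le_card_sum_add_card Finset.univ _ fun i _ => hne i).2
    simp only [Finset.card_image_of_injective _ (hinj _), Finset.card_univ,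
      Fintype.card_fin] at hCD
    refine hCD.trans (Nat.add_le_add_right (Finset.card_le_card fun x hx => ?_) k)
    obtain ⟨f, hf, rfl⟩ := Finset.mem_sum_iff_exists.1 hx
    refine Finset.mem_filter.2 ⟨Finset.mem_sum_iff_exists.2 ⟨f, fun i hi => ?_, rfl⟩, ?_⟩
    · exact Finset.image_subset_image (Finset.filter_subset _ _) (hf i hi)
    · push_cast
      change ∑ i, l i • u i = _
      refine Finset.sum_congr rfl fun i hi => ?_
      obtain ⟨b, hb, hbf⟩ := Finset.mem_image.1 (hf i hi)
      rw [← hbf]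
      refine (Finset.mem_filter.1 hb).2.trans ?_
      simp
  have hsum := Finset.sum_le_sum fun u (_ : u ∈ Finset.univ) => hmain u
  have hleft : Q ^ k * ∑ i, (l i).natAbs * (B i).card ≤
      Q * ∑ u, ∑ i, ((B i).filter fun b : ℤ => χ i u = l i • (b : ZMod Q)).card := by
    rw [Finset.sum_comm, Finset.mul_sum, Finset.mul_sum]
    refine Finset.sum_le_sum fun i _ => ?_
    have hcomm : ∑ u, ((B i).filter fun b : ℤ => χ i u = l i • (b : ZMod Q)).card =
        ∑ b ∈ B i, (Finset.univ.filter fun u => χ i u = l i • (b : ZMod Q)).card := by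
      simp only [Finset.card_filter]
      exact Finset.sum_comm
    rw [hcomm, Finset.mul_sum]
    calc Q ^ k * ((l i).natAbs * (B i).card) = ∑ _b ∈ B i, Q ^ k * (l i).natAbs := by
          rw [Finset.sum_const, smul_eq_mul]; ring
      _ ≤ _ := by
          refine Finset.sum_le_sum fun b _ => ?_
          have hfib := card_fibre_mul_card_image (χ i) (l i • (b : ZMod Q))
            (Finset.mem_image.2 ⟨fun _ => b, Finset.mem_univ _, rfl⟩)
          rw [hcardG] at hfib
          rw [← hfib, mul_assoc, mul_comm]
          exact Nat.mul_le_mul_right _ (hχ i)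
  have hright : Q * ∑ u, (S.filter fun x : ℤ => ψ u = (x : ZMod Q)).card = Q ^ k * S.card := by
    have hcomm : ∑ u, (S.filter fun x : ℤ => ψ u = (x : ZMod Q)).card =
        ∑ x ∈ S, (Finset.univ.filter fun u => ψ u = (x : ZMod Q)).card := by
      simp only [Finset.card_filter]
      exact Finset.sum_comm
    rw [hcomm, Finset.mul_sum, mul_comm (Q ^ k), ← smul_eq_mul, ← Finset.sum_const]
    refine Finset.sum_congr rfl fun x _ => ?_
    have hfib := card_fibre_mul_card_image ψ (x : ZMod Q) (by rw [hψ]; exact Finset.mem_univ _)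
    rw [hcardG, hψ, Finset.card_univ, ZMod.card] at hfib
    rw [mul_comm, hfib]
  rw [Finset.sum_add_distrib, Finset.sum_const, Finset.card_univ, hcardG, smul_eq_mul] at hsum
  refine Nat.le_of_mul_le_mul_left (hleft.trans ((Nat.mul_le_mul_left Q hsum).trans_eq ?_))
    (pow_pos hQ0 k)
  rw [mul_add, hright]
  ring

end FullResidues

section FullClasses

variable {k : ℕ} (l : Fin k → ℤ) (Q g : ℕ) (A : Finset ℤ)

/-- The part of `A` in a residue class modulo `g`. -/
def residueFibre (r : ZMod g) : Finset ℤ := A.filter fun a : ℤ => (a : ZMod g) = r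

/-- The classes of `A` modulo `g` are full if each of them meets all residues modulo `Q * g`
that lie above it. -/
def HasFullClasses : Prop := ∀ a ∈ A, ∀ u : ℤ, ∃ a' ∈ A, ((Q * g : ℕ) : ℤ) ∣ a' - (a + g * u)

variable {l Q g A}

lemma mul_le_card_fibre_sum_dilates (hgcd : Finset.univ.gcd l = 1) [NeZero Q]
    (hQ : ∀ i, l i ∣ Q) [NeZero g] (hA : HasFullClasses Q g A) {t : ℕ} {r : Fin k → ZMod g}
    (hr : ∀ i, t ≤ (residueFibre g A (r i)).card) (ht : 1 ≤ t) :
    (∑ i, (l i).natAbs) * t ≤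
      (residueFibre g (∑ i, A.image fun a => l i • a) (∑ i, l i • r i)).card + k * Q := by
  classical
  have hg0 : (g : ℤ) ≠ 0 := by exact_mod_cast NeZero.ne g
  have hne : ∀ i, ∃ a, a ∈ residueFibre g A (r i) := fun i =>
    Finset.card_pos.1 (lt_of_lt_of_le ht (hr i))
  choose ρ hρ using hne
  have hρ' : ∀ i, ρ i ∈ A ∧ ((ρ i : ℤ) : ZMod g) = r i := fun i => Finset.mem_filter.1 (hρ i)
  let B : Fin k → Finset ℤ := fun i => (residueFibre g A (r i)).image fun a => (a - ρ i) / g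
  have hdiv : ∀ i, ∀ a ∈ residueFibre g A (r i), g * ((a - ρ i) / g) = a - ρ i := by
    intro i a ha
    refine Int.mul_ediv_cancel' ?_
    rw [← ZMod.intCast_zmod_eq_zero_iff_dvd]
    push_cast
    rw [(Finset.mem_filter.1 ha).2, (hρ' i).2, sub_self]
  have hBcard : ∀ i, (B i).card = (residueFibre g A (r i)).card := by
    intro i
    refine Finset.card_image_of_injOn fun a ha b hb hab => ?_
    have h1 := hdiv i a ha
    have h2 := hdiv i b hb
    have hab' : (a - ρ i) / g = (b - ρ i) / g := hab
    rw [hab', h2] at h1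
    linarith
  have hBfull : ∀ i (u : ZMod Q), ∃ b ∈ B i, (b : ZMod Q) = u := by
    intro i u
    obtain ⟨a, ha, hau⟩ := hA (ρ i) (hρ' i).1 u.val
    obtain ⟨c, hc⟩ := hau
    push_cast at hc
    have hamem : a ∈ residueFibre g A (r i) := by
      refine Finset.mem_filter.2 ⟨ha, ?_⟩
      have : a = ρ i + g * (u.val + Q * c) := by linear_combination hc
      rw [this]
      push_cast
      simp [(hρ' i).2]
    refine ⟨_, Finset.mem_image_of_mem _ hamem, ?_⟩
    have h1 : (a - ρ i) / g = u.val + Q * c :=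
      mul_left_cancel₀ hg0 (by rw [hdiv i a hamem]; linear_combination hc)
    rw [h1]
    simp
  have hmain := sum_abs_mul_card_le_of_full l hgcd Q hQ B hBfull
  have hlow : (∑ i, (l i).natAbs) * t ≤ ∑ i, (l i).natAbs * (B i).card := by
    rw [Finset.sum_mul]
    refine Finset.sum_le_sum fun i _ => ?_
    rw [hBcard]
    exact Nat.mul_le_mul_left _ (hr i)
  refine hlow.trans (hmain.trans (Nat.add_le_add_right ?_ _))
  refine Finset.card_le_card_of_injOn (fun x => ∑ i, l i • ρ i + g * x) ?_ ?_
  · intro x hx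
    obtain ⟨f, hf, rfl⟩ := Finset.mem_sum_iff_exists.1 (Finset.mem_coe.1 hx)
    have hf' : ∀ i, ∃ a ∈ residueFibre g A (r i), l i • ρ i + g * f i = l i • a := by
      intro i
      obtain ⟨b, hb, hbf⟩ := Finset.mem_image.1 (hf i (Finset.mem_univ i))
      obtain ⟨a, ha, rfl⟩ := Finset.mem_image.1 hb
      refine ⟨a, ha, ?_⟩
      rw [← hbf]
      simp only [smul_eq_mul]
      linear_combination l i * hdiv i a ha
    choose a ha hfa using hf'
    have hx' : ∑ i, l i • ρ i + g * ∑ i, f i = ∑ i, l i • a i := by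
      rw [Finset.mul_sum, ← Finset.sum_add_distrib]
      exact Finset.sum_congr rfl fun i _ => hfa i
    refine Finset.mem_coe.2 (Finset.mem_filter.2 ⟨?_, ?_⟩)
    · refine Finset.mem_sum_iff_exists.2 ⟨fun i => l i • a i, fun i _ => ?_, hx'.symm⟩
      exact Finset.mem_image_of_mem _ (Finset.mem_filter.1 (ha i)).1
    · change ((∑ i, l i • ρ i + g * ∑ i, f i : ℤ) : ZMod g) = _
      rw [hx']
      push_cast
      refine Finset.sum_congr rfl fun i _ => ?_
      simp [(Finset.mem_filter.1 (ha i)).2]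
  · intro x _ y _ hxy
    have hxy' : ∑ i, l i • ρ i + g * x = ∑ i, l i • ρ i + g * y := hxy
    exact mul_left_cancel₀ hg0 (add_left_cancel hxy')

/-- Lower bound for sums of coprime dilates of a set with full classes. -/
lemma sum_natAbs_mul_card_le_of_hasFullClasses (hgcd : Finset.univ.gcd l = 1) [NeZero Q]
    (hQ : ∀ i, l i ∣ Q) [NeZero g] (hA : HasFullClasses Q g A) :
    (∑ i, (l i).natAbs) * A.card ≤ (∑ i, A.image fun a => l i • a).card +
      (∑ i, (A.image (Int.cast : ℤ → ZMod g)).image fun r => l i • r).card * (k * Q) := by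
  classical
  set S := ∑ i, A.image fun a => l i • a with hS
  set R := A.image (Int.cast : ℤ → ZMod g) with hR
  set T := ∑ i, R.image fun r => l i • r with hT
  set M := ∑ i, (l i).natAbs with hM
  let Rt : ℕ → Finset (ZMod g) := fun t => R.filter fun r => t ≤ (residueFibre g A r).card
  let Tt : ℕ → Finset (ZMod g) := fun t => ∑ i, (Rt t).image fun r => l i • r
  have hTt : ∀ t, Tt t ⊆ T := by
    intro t x hx
    obtain ⟨f, hf, rfl⟩ := Finset.mem_sum_iff_exists.1 hx
    exact Finset.mem_sum_iff_exists.2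
      ⟨f, fun i hi => Finset.image_subset_image (Finset.filter_subset _ _) (hf i hi), rfl⟩
  have hlayer : A.card = ∑ t ∈ Finset.Icc 1 A.card, (Rt t).card := by
    have hA1 : A.card = ∑ r ∈ R, (residueFibre g A r).card :=
      Finset.card_eq_sum_card_image (Int.cast : ℤ → ZMod g) A
    have hle : ∀ r, (residueFibre g A r).card ≤ A.card := fun r =>
      Finset.card_le_card (Finset.filter_subset _ _)
    have hRt : ∀ t, (Rt t).card = ∑ r ∈ R, if t ≤ (residueFibre g A r).card then 1 else 0 :=
      fun t => Finset.card_filter _ _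
    have hsum : ∀ r, ∑ t ∈ Finset.Icc 1 A.card, (if t ≤ (residueFibre g A r).card then 1 else 0)
        = (residueFibre g A r).card := by
      intro r
      have hIcc : (Finset.Icc 1 A.card).filter (fun t => t ≤ (residueFibre g A r).card) =
          Finset.Icc 1 (residueFibre g A r).card := by
        ext t
        have := hle r
        simp only [Finset.mem_filter, Finset.mem_Icc]
        omega
      rw [← Finset.card_filter, hIcc, Nat.card_Icc, Nat.add_sub_cancel]
    simp only [hRt]
    rw [Finset.sum_comm]
    simp only [hsum]
    exact hA1
  have hclass : ∀ s ∈ T, M * ((Finset.Icc 1 A.card).filter fun t => s ∈ Tt t).card ≤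
      (residueFibre g S s).card + k * Q := by
    intro s _
    rcases ((Finset.Icc 1 A.card).filter fun t => s ∈ Tt t).eq_empty_or_nonempty with h | h
    · simp [h]
    · have hmem := Finset.max'_mem _ h
      set t := Finset.max' _ h with ht
      obtain ⟨ht1, hst⟩ := Finset.mem_filter.1 hmem
      have hcard : ((Finset.Icc 1 A.card).filter fun t => s ∈ Tt t).card ≤ t := by
        have : ((Finset.Icc 1 A.card).filter fun t => s ∈ Tt t) ⊆ Finset.Icc 1 t := fun u hu =>
          Finset.mem_Icc.2 ⟨(Finset.mem_Icc.1 (Finset.mem_filter.1 hu).1).1, Finset.le_max' _ u hu⟩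
        simpa using Finset.card_le_card this
      refine (Nat.mul_le_mul_left M hcard).trans ?_
      obtain ⟨f, hf, rfl⟩ := Finset.mem_sum_iff_exists.1 hst
      have hf' : ∀ i, ∃ r ∈ Rt t, l i • r = f i := fun i =>
        Finset.mem_image.1 (hf i (Finset.mem_univ i))
      choose r hr hrf using hf'
      rw [← Finset.sum_congr rfl fun i _ => hrf i]
      exact mul_le_card_fibre_sum_dilates hgcd hQ hA (fun i => (Finset.mem_filter.1 (hr i)).2)
        (Finset.mem_Icc.1 ht1).1
  calc M * A.card ≤ M * ∑ t ∈ Finset.Icc 1 A.card, (Tt t).card := by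
        conv_lhs => rw [hlayer]
        exact Nat.mul_le_mul_left _
          (Finset.sum_le_sum fun t _ => card_le_card_sum_dilates l hgcd (Rt t))
    _ = M * ∑ t ∈ Finset.Icc 1 A.card, ∑ s ∈ T, if s ∈ Tt t then 1 else 0 := by
        congr 1
        refine Finset.sum_congr rfl fun t _ => ?_
        rw [← Finset.card_filter, Finset.filter_mem_eq_inter, Finset.inter_eq_right.2 (hTt t)]
    _ = ∑ s ∈ T, M * ((Finset.Icc 1 A.card).filter fun t => s ∈ Tt t).card := by
        rw [Finset.sum_comm, Finset.mul_sum]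
        simp only [Finset.card_filter]
    _ ≤ ∑ s ∈ T, ((residueFibre g S s).card + k * Q) := Finset.sum_le_sum hclass
    _ ≤ S.card + T.card * (k * Q) := by
        rw [Finset.sum_add_distrib, Finset.sum_const, smul_eq_mul]
        refine Nat.add_le_add_right ?_ _
        exact (Finset.sum_card_fiberwise_eq_card_filter S T _).trans_le
          (Finset.card_le_card (Finset.filter_subset _ _))

end FullClasses

section Residues

/-- The number of residue classes modulo `g` that meet `A`. -/
def residueCount (g : ℕ) (A : Finset ℤ) : ℕ := (A.image (Int.cast : ℤ → ZMod g)).card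

lemma residueCount_zero (A : Finset ℤ) : residueCount 0 A = A.card :=
  Finset.card_image_of_injective _ Int.cast_injective

lemma residueCount_mono (g : ℕ) {A B : Finset ℤ} (h : A ⊆ B) :
    residueCount g A ≤ residueCount g B :=
  Finset.card_le_card (Finset.image_subset_image h)

lemma residueCount_le_of_forall_dvd {g h : ℕ} {A : Finset ℤ}
    (H : ∀ a ∈ A, ∀ b ∈ A, (h : ℤ) ∣ b - a → (g : ℤ) ∣ b - a) :
    residueCount g A ≤ residueCount h A := by
  classical
  have hex : ∀ x : ZMod g, ∃ a : ℤ, x ∈ A.image (Int.cast : ℤ → ZMod g) →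
      a ∈ A ∧ (a : ZMod g) = x := by
    intro x
    by_cases hx : x ∈ A.image (Int.cast : ℤ → ZMod g)
    · obtain ⟨a, ha, hax⟩ := Finset.mem_image.1 hx
      exact ⟨a, fun _ => ⟨ha, hax⟩⟩
    · exact ⟨0, fun h => absurd h hx⟩
  choose s hs using hex
  refine Finset.card_le_card_of_injOn (fun x => (s x : ZMod h)) ?_ ?_
  · intro x hx
    exact Finset.mem_coe.2 (Finset.mem_image_of_mem _ (hs x hx).1)
  · intro x hx y hy hxy
    have h1 := H _ (hs x hx).1 _ (hs y hy).1 ((ZMod.intCast_eq_intCast_iff_dvd_sub _ _ _).1 hxy)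
    rw [← (hs x hx).2, ← (hs y hy).2]
    exact (ZMod.intCast_eq_intCast_iff_dvd_sub _ _ _).2 h1

lemma residueCount_le_of_dvd {g h : ℕ} (hgh : g ∣ h) (A : Finset ℤ) :
    residueCount g A ≤ residueCount h A :=
  residueCount_le_of_forall_dvd fun _ _ _ _ H => (Int.natCast_dvd_natCast.2 hgh).trans H

/-- The residues modulo `Q * g` that lie above the class of `a` modulo `g`. -/
def lifts (Q g : ℕ) (a : ℤ) : Finset (ZMod (Q * g)) :=
  (Finset.range Q).image fun v : ℕ => ((a + g * v : ℤ) : ZMod (Q * g))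

lemma card_lifts_le (Q g : ℕ) (a : ℤ) : (lifts Q g a).card ≤ Q :=
  Finset.card_image_le.trans (Finset.card_range Q).le

lemma add_mul_mem_lifts {Q : ℕ} [NeZero Q] (g : ℕ) (a u : ℤ) :
    ((a + g * u : ℤ) : ZMod (Q * g)) ∈ lifts Q g a := by
  have hQ : (0 : ℤ) < Q := by exact_mod_cast NeZero.pos Q
  have h0 := Int.emod_nonneg u hQ.ne'
  have h1 := Int.emod_lt_of_pos u hQ
  refine Finset.mem_image.2 ⟨(u % Q).toNat, Finset.mem_range.2 (by omega), ?_⟩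
  rw [ZMod.intCast_eq_intCast_iff_dvd_sub, Int.toNat_of_nonneg h0]
  refine ⟨u / Q, ?_⟩
  push_cast
  linear_combination -(g : ℤ) * Int.mul_ediv_add_emod u Q

lemma mem_lifts_of_dvd {Q : ℕ} [NeZero Q] {g : ℕ} {a b : ℤ} (h : (g : ℤ) ∣ b - a) :
    (b : ZMod (Q * g)) ∈ lifts Q g a := by
  obtain ⟨u, hu⟩ := h
  rw [show b = a + g * u by linear_combination hu]
  exact add_mul_mem_lifts g a u

/-- The number of residues modulo `Q * g` is bounded in terms of the classes modulo `g` that are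
not full. -/
lemma card_add_residueCount_mul_le (Q : ℕ) [NeZero Q] (g : ℕ) (A : Finset ℤ)
    (bad : Finset (ZMod g)) (hbad : bad ⊆ A.image (Int.cast : ℤ → ZMod g))
    (H : ∀ r ∈ bad, ∃ a ∈ A, (a : ZMod g) = r ∧ ∃ u : ℤ, ∀ a' ∈ A,
      ¬ ((Q * g : ℕ) : ℤ) ∣ a' - (a + g * u)) :
    bad.card + residueCount (Q * g) A ≤ Q * residueCount g A := by
  classical
  let π : ZMod (Q * g) →+* ZMod g := ZMod.castHom (Dvd.intro_left Q rfl) (ZMod g)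
  set R := A.image (Int.cast : ℤ → ZMod g) with hR
  set R' := A.image (Int.cast : ℤ → ZMod (Q * g)) with hR'
  have hmaps : ∀ x ∈ R', π x ∈ R := by
    intro x hx
    obtain ⟨a, ha, rfl⟩ := Finset.mem_image.1 hx
    rw [map_intCast]
    exact Finset.mem_image_of_mem _ ha
  have hfib : ∀ a ∈ A, (R'.filter fun x => π x = a) ⊆ lifts Q g a := by
    intro a ha x hx
    obtain ⟨hx, hxa⟩ := Finset.mem_filter.1 hx
    obtain ⟨b, hb, rfl⟩ := Finset.mem_image.1 hx
    rw [map_intCast] at hxa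
    exact mem_lifts_of_dvd ((ZMod.intCast_eq_intCast_iff_dvd_sub _ _ _).1 hxa.symm)
  have hle : ∀ r ∈ R, (if r ∈ bad then 1 else 0) + (R'.filter fun x => π x = r).card ≤ Q := by
    intro r hr
    split_ifs with hrb
    · obtain ⟨a, ha, rfl, u, hu⟩ := H r hrb
      have hmem := add_mul_mem_lifts (Q := Q) g a u
      have hsub : (R'.filter fun x => π x = a) ⊆
          (lifts Q g a).erase ((a + g * u : ℤ) : ZMod (Q * g)) := by
        refine fun x hx => Finset.mem_erase.2 ⟨?_, hfib a ha hx⟩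
        rintro rfl
        obtain ⟨b, hb, hbe⟩ := Finset.mem_image.1 (Finset.mem_filter.1 hx).1
        exact hu b hb ((ZMod.intCast_eq_intCast_iff_dvd_sub _ _ _).1 hbe.symm)
      have h1 := Finset.card_le_card hsub
      have h2 := Finset.card_erase_add_one hmem
      have h3 := card_lifts_le Q g a
      omega
    · obtain ⟨a, ha, rfl⟩ := Finset.mem_image.1 hr
      rw [zero_add]
      exact (Finset.card_le_card (hfib a ha)).trans (card_lifts_le Q g a)
  have hsum := Finset.sum_le_sum hle
  rw [Finset.sum_add_distrib, ← Finset.card_filter, Finset.filter_mem_eq_inter,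
    Finset.inter_eq_right.2 hbad, ← Finset.card_eq_sum_card_fiberwise hmaps, Finset.sum_const,
    smul_eq_mul] at hsum
  exact hsum.trans (mul_comm _ _).le

lemma residueCount_mul_le (Q : ℕ) [NeZero Q] (g : ℕ) (A : Finset ℤ) :
    residueCount (Q * g) A ≤ Q * residueCount g A := by
  simpa using card_add_residueCount_mul_le Q g A ∅ (by simp) (by simp)

/-- Discarding the classes that are not full costs little when most residues modulo `Q * g` above
the classes of `A` modulo `g` are present. -/
lemma exists_hasFullClasses_subset (Q : ℕ) [NeZero Q] (g : ℕ) (A : Finset ℤ) {K : ℕ}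
    (hK : (A - A).card ≤ K * A.card) :
    ∃ B ⊆ A, HasFullClasses Q g B ∧ ∃ b : ℕ, b + residueCount (Q * g) A ≤ Q * residueCount g A ∧
      residueCount g A * A.card ≤ residueCount g A * B.card + b * (K * A.card) := by
  classical
  let good : ℤ → Prop := fun a => ∀ u : ℤ, ∃ a' ∈ A, ((Q * g : ℕ) : ℤ) ∣ a' - (a + g * u)
  let C := A.filter fun a => ¬ good a
  refine ⟨A.filter good, Finset.filter_subset _ _, ?_, (C.image (Int.cast : ℤ → ZMod g)).card,
    ?_, ?_⟩
  · intro a ha u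
    have hgood := (Finset.mem_filter.1 ha).2
    obtain ⟨a', ha', hdvd⟩ := hgood u
    refine ⟨a', Finset.mem_filter.2 ⟨ha', fun v => ?_⟩, hdvd⟩
    obtain ⟨a'', ha'', hdvd'⟩ := hgood (u + v)
    refine ⟨a'', ha'', ?_⟩
    have := dvd_sub hdvd' hdvd
    rwa [show a'' - (a + g * (u + v)) - (a' - (a + g * u)) = a'' - (a' + g * v) by ring] at this
  · refine card_add_residueCount_mul_le Q g A _
      (Finset.image_subset_image (Finset.filter_subset _ _)) fun r hr => ?_
    obtain ⟨a, ha, har⟩ := Finset.mem_image.1 hr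
    obtain ⟨haA, hbad⟩ := Finset.mem_filter.1 ha
    have hbad' : ∃ u : ℤ, ∀ a' ∈ A, ¬ ((Q * g : ℕ) : ℤ) ∣ a' - (a + g * u) := by
      simpa [good] using hbad
    exact ⟨a, haA, har, hbad'⟩
  · have hsplit : (A.filter good).card + C.card = A.card := Finset.card_filter_add_card_filter_not _
    have hfib : ∀ r : ZMod g, residueCount g A * (residueFibre g C r).card ≤ K * A.card := by
      intro r
      have h := card_image_mul_card_le_of_fibre (Int.castAddHom (ZMod g)) A
        (-(residueFibre g C r)) (c := -r) (by
          intro y hy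
          have := (Finset.mem_filter.1 (Finset.mem_neg'.1 hy)).2
          push_cast at this
          simp [← this])
      rw [Finset.card_neg, ← sub_eq_add_neg] at h
      refine h.trans ((Finset.card_le_card (Finset.sub_subset_sub_left ?_)).trans hK)
      exact (Finset.filter_subset _ _).trans (Finset.filter_subset _ _)
    have hC : C.card = ∑ r ∈ C.image (Int.cast : ℤ → ZMod g), (residueFibre g C r).card :=
      Finset.card_eq_sum_card_image (Int.cast : ℤ → ZMod g) C
    rw [← hsplit, mul_add, hsplit]
    refine Nat.add_le_add_left ?_ _
    rw [hC, Finset.mul_sum, ← smul_eq_mul, ← Finset.sum_const]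
    exact Finset.sum_le_sum fun r _ => hfib r

lemma mul_residueCount_le {Q g : ℕ} [NeZero Q] (hg : g ≠ 0) (X Y : Finset ℤ)
    (hY : ∀ u : ℤ, ∃ y ∈ Y, ((Q * g : ℕ) : ℤ) ∣ y - g * u) :
    Q * residueCount g X ≤ residueCount (Q * g) (X + Y) := by
  classical
  choose y hyY hy using hY
  have hex : ∀ r : X.image (Int.cast : ℤ → ZMod g), ∃ a ∈ X, (a : ZMod g) = r := fun r =>
    Finset.mem_image.1 r.2
  choose x hxX hx using hex
  have hcard : Q * residueCount g X =
      (Finset.range Q ×ˢ (X.image (Int.cast : ℤ → ZMod g)).attach).card := by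
    rw [Finset.card_product, Finset.card_range, Finset.card_attach, residueCount]
  rw [hcard]
  refine Finset.card_le_card_of_injOn
    (fun z : ℕ × _ => ((x z.2 + y z.1 : ℤ) : ZMod (Q * g))) ?_ ?_
  · intro z _
    exact Finset.mem_coe.2 (Finset.mem_image_of_mem _ (Finset.add_mem_add (hxX _) (hyY _)))
  · rintro ⟨v, r⟩ hv ⟨w, s⟩ hw h
    have hv' : v < Q := by simpa using hv
    have hw' : w < Q := by simpa using hw
    obtain ⟨c, hc⟩ := (ZMod.intCast_eq_intCast_iff_dvd_sub _ _ _).1 h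
    obtain ⟨c₁, hc₁⟩ := hy v
    obtain ⟨c₂, hc₂⟩ := hy w
    push_cast at hc hc₁ hc₂
    have hrs : r = s := by
      refine Subtype.ext ?_
      rw [← hx r, ← hx s, ZMod.intCast_eq_intCast_iff_dvd_sub]
      exact ⟨Q * c + v + Q * c₁ - w - Q * c₂, by linear_combination hc + hc₁ - hc₂⟩
    subst hrs
    have hg' : (g : ℤ) ≠ 0 := by exact_mod_cast hg
    have hvw : (w : ℤ) - v = Q * (c + c₁ - c₂) :=
      mul_left_cancel₀ hg' (by linear_combination hc + hc₁ - hc₂)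
    have : v ≡ w [MOD Q] := (Int.natCast_modEq_iff).1 (Int.modEq_iff_dvd.2 ⟨_, hvw⟩)
    rw [Nat.ModEq, Nat.mod_eq_of_lt hv', Nat.mod_eq_of_lt hw'] at this
    rw [this]

lemma exists_mem_iteratedSumset_dvd_sub {E : Finset ℤ} (h0 : (0 : ℤ) ∈ E)
    (hg : E.gcd id ≠ 0) (Q : ℕ) [NeZero Q] (u : ℤ) :
    ∃ y ∈ iteratedSumset E Q, (Q : ℤ) * E.gcd id ∣ y - E.gcd id * u := by
  classical
  set g := E.gcd id with hgdef
  let S : Set (ZMod Q) := {x | ∃ e ∈ E, ∃ c : ℤ, e = g * c ∧ (c : ZMod Q) = x}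
  have h0S : (0 : ZMod Q) ∈ S := ⟨0, h0, 0, by simp, by simp⟩
  let H := smulCardAddSubgroup S ⟨0, h0S⟩
  have hmem : ∀ x, x ∈ H ↔ x ∈ Q • S := by
    intro x
    have : (H : Set (ZMod Q)) = Fintype.card (ZMod Q) • S := rfl
    rw [← SetLike.mem_coe, this, ZMod.card]
  have hlift : ∀ n : ℕ, ∀ x ∈ n • S, ∃ y ∈ iteratedSumset E n,
      ∃ c : ℤ, y = g * c ∧ (c : ZMod Q) = x := by
    intro n
    induction n with
    | zero =>
      intro x hx
      refine ⟨0, by simp [iteratedSumset], 0, by simp, ?_⟩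
      rw [zero_nsmul, Set.mem_zero] at hx
      simp [hx]
    | succ n ih =>
      intro x hx
      rw [succ_nsmul] at hx
      obtain ⟨a, ha, b, ⟨e, he, c, hec, hcb⟩, rfl⟩ := Set.mem_add.1 hx
      obtain ⟨y, hy, d, hd, hda⟩ := ih a ha
      exact ⟨y + e, Finset.add_mem_add hy he, d + c, by rw [hd, hec]; ring, by simp [hcb, hda]⟩
  have hSH : ∀ x ∈ S, x ∈ H := by
    intro x hx
    rw [hmem]
    have hsucc : ∀ q : ℕ, q ≠ 0 → x ∈ q • S := by
      intro q hq
      obtain ⟨q, rfl⟩ := Nat.exists_eq_succ_of_ne_zero hq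
      rw [Nat.succ_eq_add_one, succ_nsmul]
      refine Set.mem_add.2 ⟨0, ?_, x, hx, zero_add x⟩
      simpa using Set.nsmul_mem_nsmul h0S (n := q)
    exact hsucc Q (NeZero.ne Q)
  have h1 : (1 : ZMod Q) ∈ H := by
    obtain ⟨f, hf⟩ := Finset.gcd_eq_sum_mul E (id : ℤ → ℤ)
    have hdvd : ∀ e ∈ E, e = g * (e / g) := fun e he =>
      (Int.mul_ediv_cancel' (Finset.gcd_dvd (f := id) he)).symm
    have hone : (1 : ℤ) = ∑ e ∈ E, f e * (e / g) := by
      refine mul_left_cancel₀ hg ?_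
      rw [Finset.mul_sum, mul_one]
      conv_lhs => rw [hgdef, hf]
      refine Finset.sum_congr rfl fun e he => ?_
      have := hdvd e he
      simp only [id]
      linear_combination f e * this
    have hcast : (1 : ZMod Q) = ∑ e ∈ E, f e • ((e / g : ℤ) : ZMod Q) := by
      have := congrArg (Int.cast : ℤ → ZMod Q) hone
      push_cast at this
      simpa using this
    rw [hcast]
    exact sum_mem fun e he => zsmul_mem (hSH _ ⟨e, he, e / g, hdvd e he, rfl⟩) _
  have hu : ((u : ℤ) : ZMod Q) ∈ H := by
    have := zsmul_mem h1 u
    simpa using this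
  obtain ⟨y, hy, c, rfl, hc⟩ := hlift Q _ ((hmem _).1 hu)
  obtain ⟨d, hd⟩ := (ZMod.intCast_eq_intCast_iff_dvd_sub _ _ _).1 hc.symm
  exact ⟨_, hy, d, by linear_combination g * hd⟩

end Residues

section Tower

/-- The greatest common divisor of the multiples of `c` in `D`. -/
def multiplesGcd (D : Finset ℤ) (c : ℕ) : ℕ := ((D.filter fun d : ℤ => (c : ℤ) ∣ d).gcd id).natAbs

/-- Moduli `g₀, g₁, …` where `g₀` is the greatest common divisor of `D` and `gₙ₊₁` that of the
multiples of `Q * gₙ` in `D`. -/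
def modulusTower (Q : ℕ) (D : Finset ℤ) : ℕ → ℕ
  | 0 => multiplesGcd D 1
  | n + 1 => multiplesGcd D (Q * modulusTower Q D n)

lemma dvd_multiplesGcd (D : Finset ℤ) (c : ℕ) : c ∣ multiplesGcd D c := by
  rw [multiplesGcd, ← Int.natCast_dvd]
  exact Finset.dvd_gcd fun d hd => (Finset.mem_filter.1 hd).2

lemma multiplesGcd_dvd {D : Finset ℤ} {c : ℕ} {d : ℤ} (hd : d ∈ D) (hc : (c : ℤ) ∣ d) :
    (multiplesGcd D c : ℤ) ∣ d := by
  rw [multiplesGcd, Int.natAbs_dvd]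
  exact Finset.gcd_dvd (f := id) (Finset.mem_filter.2 ⟨hd, hc⟩)

lemma exists_mem_iteratedSumset_multiplesGcd_dvd {D : Finset ℤ} (h0 : (0 : ℤ) ∈ D) {c : ℕ}
    (hc : multiplesGcd D c ≠ 0) (Q : ℕ) [NeZero Q] (u : ℤ) :
    ∃ y ∈ iteratedSumset D Q, ((Q * multiplesGcd D c : ℕ) : ℤ) ∣ y - multiplesGcd D c * u := by
  have h0' : (0 : ℤ) ∈ D.filter fun d : ℤ => (c : ℤ) ∣ d :=
    Finset.mem_filter.2 ⟨h0, dvd_zero _⟩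
  have hnat : ((multiplesGcd D c : ℕ) : ℤ) = (D.filter fun d : ℤ => (c : ℤ) ∣ d).gcd id := by
    rw [multiplesGcd, Int.natCast_natAbs, Int.abs_eq_normalize, Finset.normalize_gcd]
  have hc' : (D.filter fun d : ℤ => (c : ℤ) ∣ d).gcd id ≠ 0 := by
    rw [← hnat]
    exact_mod_cast hc
  obtain ⟨y, hy, hdvd⟩ := exists_mem_iteratedSumset_dvd_sub h0' hc' Q u
  refine ⟨y, iteratedSumset_mono_left (Finset.filter_subset _ _) Q hy, ?_⟩
  push_cast
  rwa [hnat]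

lemma exists_modulusTower_eq (Q : ℕ) (D : Finset ℤ) (n : ℕ) :
    ∃ c, modulusTower Q D n = multiplesGcd D c := by
  cases n with
  | zero => exact ⟨1, rfl⟩
  | succ n => exact ⟨_, rfl⟩

variable {Q : ℕ} {A : Finset ℤ}

lemma residueCount_modulusTower_succ_le (n : ℕ) :
    residueCount (modulusTower Q (A - A) (n + 1)) A ≤
      residueCount (Q * modulusTower Q (A - A) n) A :=
  residueCount_le_of_forall_dvd fun _ ha _ hb h => multiplesGcd_dvd (Finset.sub_mem_sub hb ha) h

lemma residueCount_modulusTower_zero_le : residueCount (modulusTower Q (A - A) 0) A ≤ 1 := by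
  refine Finset.card_le_one.2 fun x hx y hy => ?_
  obtain ⟨a, ha, rfl⟩ := Finset.mem_image.1 hx
  obtain ⟨b, hb, rfl⟩ := Finset.mem_image.1 hy
  refine (ZMod.intCast_eq_intCast_iff_dvd_sub _ _ _).2 ?_
  exact multiplesGcd_dvd (Finset.sub_mem_sub hb ha) (by simp)

variable [NeZero Q]

lemma residueCount_modulusTower_le (n : ℕ) :
    residueCount (modulusTower Q (A - A) n) A ≤ Q ^ n := by
  induction n with
  | zero => simpa using residueCount_modulusTower_zero_le
  | succ n ih =>
    calc _ ≤ _ := residueCount_modulusTower_succ_le n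
      _ ≤ Q * residueCount (modulusTower Q (A - A) n) A := residueCount_mul_le Q _ A
      _ ≤ Q * Q ^ n := Nat.mul_le_mul_left _ ih
      _ = Q ^ (n + 1) := (pow_succ' Q n).symm

lemma modulusTower_ne_zero {m n : ℕ} (hm : Q ^ m < A.card) (hn : n ≤ m) :
    modulusTower Q (A - A) n ≠ 0 := by
  intro h
  have h1 := residueCount_modulusTower_le (Q := Q) (A := A) n
  rw [h, residueCount_zero] at h1
  have h2 := Nat.pow_le_pow_right (NeZero.pos Q) hn
  omega

lemma pow_le_residueCount_iteratedSumset {m : ℕ} (hm : Q ^ m < A.card) {n : ℕ} (hn : n ≤ m) :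
    Q ^ n ≤ residueCount (modulusTower Q (A - A) n) (iteratedSumset (A - A) (n * Q)) := by
  have hA : A.Nonempty := Finset.card_pos.1 (by omega)
  obtain ⟨a₀, ha₀⟩ := hA
  have h0 : (0 : ℤ) ∈ A - A := by simpa using Finset.sub_mem_sub ha₀ ha₀
  induction n with
  | zero =>
    rw [pow_zero, Nat.one_le_iff_ne_zero, ← Nat.pos_iff_ne_zero]
    exact Finset.card_pos.2 (Finset.Nonempty.image ⟨0, zero_mem_iteratedSumset h0 _⟩ _)
  | succ n ih =>
    have hne := modulusTower_ne_zero (Q := Q) hm (Nat.le_of_succ_le hn)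
    have hfull : ∀ u : ℤ, ∃ y ∈ iteratedSumset (A - A) Q,
        ((Q * modulusTower Q (A - A) n : ℕ) : ℤ) ∣ y - modulusTower Q (A - A) n * u := by
      obtain ⟨c, hc⟩ := exists_modulusTower_eq Q (A - A) n
      rw [hc] at hne ⊢
      exact exists_mem_iteratedSumset_multiplesGcd_dvd h0 hne Q
    calc Q ^ (n + 1) = Q * Q ^ n := pow_succ' Q n
      _ ≤ Q * residueCount (modulusTower Q (A - A) n) (iteratedSumset (A - A) (n * Q)) :=
        Nat.mul_le_mul_left _ (ih (Nat.le_of_succ_le hn))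
      _ ≤ residueCount (Q * modulusTower Q (A - A) n)
          (iteratedSumset (A - A) (n * Q) + iteratedSumset (A - A) Q) :=
        mul_residueCount_le hne _ _ hfull
      _ ≤ _ := by
        rw [← iteratedSumset_add, Nat.add_mul, one_mul]
        exact residueCount_le_of_dvd (dvd_multiplesGcd _ _) _

lemma pow_le_residueCount_mul {K m : ℕ} (hK : (A - A).card ≤ K * A.card) (hm : Q ^ m < A.card) :
    Q ^ m ≤ residueCount (modulusTower Q (A - A) m) A * (K * (m * Q + 2) ^ K ^ 5) := by
  have hA : A.Nonempty := Finset.card_pos.1 (by omega)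
  have hA' := hA
  obtain ⟨a₀, ha₀⟩ := hA'
  refine Nat.le_of_mul_le_mul_right ?_ (Finset.card_pos.2 hA)
  have h1 := pow_le_residueCount_iteratedSumset (Q := Q) hm le_rfl
  have h2 := card_image_mul_card_le (Int.castAddHom (ZMod (modulusTower Q (A - A) m)))
    (iteratedSumset (A - A) (m * Q)) A
  have h3 : (iteratedSumset (A - A) (m * Q) + A).card ≤
      (iteratedSumset (A - A) (m * Q + 1)).card := by
    refine Finset.card_le_card_of_injOn (fun x => x - a₀) ?_ (sub_left_injective.injOn)
    intro x hx
    obtain ⟨y, hy, a, ha, rfl⟩ := Finset.mem_add.1 (Finset.mem_coe.1 hx)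
    exact Finset.mem_coe.2 (Finset.mem_add.2
      ⟨y, hy, a - a₀, Finset.sub_mem_sub ha ha₀, (add_sub_assoc y a a₀).symm⟩)
  have h4 := card_iteratedSumset_sub_le hA hK (m * Q + 1)
  calc Q ^ m * A.card ≤ _ := Nat.mul_le_mul_right _ h1
    _ ≤ _ := h2
    _ ≤ _ := Nat.mul_le_mul_left _ (h3.trans h4)
    _ = _ := (mul_assoc _ _ _).symm

/-- Some modulus in the tower has the property that almost all residues modulo `Q * g` above the
classes of `A` modulo `g` are present in `A`. -/
lemma exists_modulus {K m : ℕ} {δ : ℝ} (hδ : δ ≤ 1) (hK : (A - A).card ≤ K * A.card)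
    (hm : Q ^ m < A.card) (hδm : (1 - δ) ^ m * (K * (m * Q + 2) ^ K ^ 5) < 1) :
    ∃ g, g ≠ 0 ∧ residueCount g A ≤ Q ^ m ∧
      Q * (1 - δ) * residueCount g A ≤ residueCount (Q * g) A := by
  by_contra! hcon
  have hQ : (0 : ℝ) < Q := by exact_mod_cast NeZero.pos Q
  have hc : 0 ≤ Q * (1 - δ) := mul_nonneg hQ.le (by linarith)
  have hind : ∀ n ≤ m, (residueCount (modulusTower Q (A - A) n) A : ℝ) ≤ (Q * (1 - δ)) ^ n := by
    intro n
    induction n with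
    | zero =>
      intro _
      have := residueCount_modulusTower_zero_le (Q := Q) (A := A)
      simpa using this
    | succ n ih =>
      intro hn
      have h1 := hcon _ (modulusTower_ne_zero (Q := Q) hm (Nat.le_of_succ_le hn))
        ((residueCount_modulusTower_le n).trans
          (Nat.pow_le_pow_right (NeZero.pos Q) (Nat.le_of_succ_le hn)))
      have h2 : (residueCount (modulusTower Q (A - A) (n + 1)) A : ℝ) ≤
          residueCount (Q * modulusTower Q (A - A) n) A := by
        exact_mod_cast residueCount_modulusTower_succ_le n
      rw [pow_succ']
      exact h2.trans (h1.le.trans (mul_le_mul_of_nonneg_left (ih (Nat.le_of_succ_le hn)) hc))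
  have h1 : (Q : ℝ) ^ m ≤ residueCount (modulusTower Q (A - A) m) A *
      (K * (m * Q + 2) ^ K ^ 5) := by
    exact_mod_cast pow_le_residueCount_mul hK hm
  have h2 := mul_le_mul_of_nonneg_right (hind m le_rfl)
    (show (0 : ℝ) ≤ K * (m * Q + 2) ^ K ^ 5 by positivity)
  have h3 : (Q : ℝ) ^ m * ((1 - δ) ^ m * (K * (m * Q + 2) ^ K ^ 5)) < (Q : ℝ) ^ m * 1 :=
    mul_lt_mul_of_pos_left hδm (by positivity)
  rw [mul_pow] at h2
  linarith

end Tower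

section Integers

lemma exists_pow_mul_lt_one {δ : ℝ} (hδ : 0 < δ) (hδ' : δ ≤ 1) (K Q d : ℕ) :
    ∃ m : ℕ, (1 - δ) ^ m * (K * (m * Q + 2) ^ d) < (1 : ℝ) := by
  have h1 := (tendsto_pow_const_mul_const_pow_of_abs_lt_one d
    (r := 1 - δ) (by rw [abs_lt]; constructor <;> linarith)).const_mul (K * (Q + 2 : ℝ) ^ d)
  rw [mul_zero] at h1
  obtain ⟨m, hm, hm1⟩ := ((h1.eventually (gt_mem_nhds zero_lt_one)).and
    (Filter.eventually_ge_atTop 1)).exists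
  refine ⟨m, lt_of_le_of_lt ?_ hm⟩
  have hm1' : (1 : ℝ) ≤ m := by exact_mod_cast hm1
  have h2 : (m * Q + 2 : ℝ) ^ d ≤ ((Q + 2) * m) ^ d :=
    pow_le_pow_left₀ (by positivity) (by nlinarith) d
  rw [mul_pow] at h2
  have h3 : 0 ≤ (1 - δ) ^ m := pow_nonneg (by linarith) m
  calc (1 - δ) ^ m * (K * (m * Q + 2) ^ d)
      ≤ (1 - δ) ^ m * (K * ((Q + 2 : ℝ) ^ d * m ^ d)) := by gcongr
    _ = _ := by ring

lemma Finset.card_sum_le_prod_card {G ι : Type*} [AddCommGroup G] [DecidableEq G] (I : Finset ι)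
    (S : ι → Finset G) : (∑ i ∈ I, S i).card ≤ ∏ i ∈ I, (S i).card := by
  classical
  induction I using Finset.induction_on with
  | empty => simp
  | insert i I hi ih =>
    rw [Finset.sum_insert hi, Finset.prod_insert hi]
    exact Finset.card_add_le.trans (Nat.mul_le_mul_left _ ih)

/-- Sums of coprime dilates of large sets of integers with small doubling. -/
lemma exists_le_card_sum_dilates_int {k : ℕ} (l : Fin k → ℤ) (hl : ∀ i, l i ≠ 0)
    (hgcd : Finset.univ.gcd l = 1) (K : ℕ) {ε : ℝ} (hε : 0 < ε) :
    ∃ N : ℕ, ∀ A : Finset ℤ, N ≤ A.card → (A - A).card ≤ K * A.card →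
      (((∑ i, (l i).natAbs : ℕ) : ℝ) - ε) * A.card ≤
        ((∑ i, A.image fun a => l i • a).card : ℝ) := by
  set M := ∑ i, (l i).natAbs
  set Q := ∏ i, (l i).natAbs
  have hQ0 : Q ≠ 0 := Finset.prod_ne_zero_iff.2 fun i _ => Int.natAbs_ne_zero.2 (hl i)
  have : NeZero Q := ⟨hQ0⟩
  have hlQ : ∀ i, l i ∣ Q := fun i =>
    Int.dvd_natCast.2 (Finset.dvd_prod_of_mem (fun i => (l i).natAbs) (Finset.mem_univ i))
  set δ : ℝ := min 1 (ε / (2 * (M * Q * K + 1)))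
  have hδ0 : 0 < δ := lt_min one_pos (by positivity)
  have hδ1 : δ ≤ 1 := min_le_left _ _
  have hδε : M * Q * K * δ ≤ ε / 2 := by
    have h1 : δ ≤ ε / (2 * (M * Q * K + 1)) := min_le_right _ _
    rw [le_div_iff₀ (by positivity)] at h1
    linarith
  obtain ⟨m, hm⟩ := exists_pow_mul_lt_one hδ0 hδ1 K Q (K ^ 5)
  refine ⟨max (Q ^ m + 1) ⌈(Q ^ m) ^ k * (k * Q) * 2 / ε⌉₊, fun A hN hK => ?_⟩
  have hAm : Q ^ m < A.card := le_trans (le_max_left _ _) hN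
  have hAε : ((Q ^ m) ^ k * (k * Q) : ℝ) ≤ ε / 2 * A.card := by
    have h1 : (Q ^ m) ^ k * (k * Q) * 2 / ε ≤ (A.card : ℝ) :=
      (Nat.le_ceil _).trans (by exact_mod_cast (le_max_right _ _).trans hN)
    rw [div_le_iff₀ hε] at h1
    linarith
  obtain ⟨g, hg, hgQ, hgδ⟩ := exists_modulus hδ1 hK hAm hm
  have : NeZero g := ⟨hg⟩
  obtain ⟨B, hBA, hB, b, hb1, hb2⟩ := exists_hasFullClasses_subset Q g A hK
  have hr : (0 : ℝ) < residueCount g A := by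
    exact_mod_cast Finset.card_pos.2
      (Finset.Nonempty.image (Finset.card_pos.1 (lt_of_le_of_lt (Nat.zero_le _) hAm)) _)
  have hBcard : (A.card : ℝ) * (1 - Q * K * δ) ≤ B.card := by
    have hb1' : (b : ℝ) + residueCount (Q * g) A ≤ Q * residueCount g A := by exact_mod_cast hb1
    have hb2' : (residueCount g A : ℝ) * A.card ≤ residueCount g A * B.card +
        b * (K * A.card) := by exact_mod_cast hb2
    have hb3 : (b : ℝ) ≤ Q * δ * residueCount g A := by linarith
    have hb4 := mul_le_mul_of_nonneg_right hb3 (show (0 : ℝ) ≤ K * A.card by positivity)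
    refine le_of_mul_le_mul_left ?_ hr
    linarith
  have hmain := sum_natAbs_mul_card_le_of_hasFullClasses hgcd hlQ hB
  have hT : (∑ i, (B.image (Int.cast : ℤ → ZMod g)).image fun r => l i • r).card ≤
      (Q ^ m) ^ k := by
    refine (Finset.card_sum_le_prod_card _ _).trans ?_
    refine (Finset.prod_le_pow_card _ _ (Q ^ m) fun i _ => ?_).trans (by simp)
    exact Finset.card_image_le.trans ((residueCount_mono g hBA).trans hgQ)
  have hS : (∑ i, B.image fun a => l i • a).card ≤ (∑ i, A.image fun a => l i • a).card := by
    refine Finset.card_le_card fun x hx => ?_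
    obtain ⟨f, hf, rfl⟩ := Finset.mem_sum_iff_exists.1 hx
    exact Finset.mem_sum_iff_exists.2
      ⟨f, fun i hi => Finset.image_subset_image hBA (hf i hi), rfl⟩
  have hfinal : (M : ℝ) * B.card ≤ (∑ i, A.image fun a => l i • a).card +
      (Q ^ m) ^ k * (k * Q) := by
    exact_mod_cast hmain.trans (Nat.add_le_add hS (Nat.mul_le_mul_right _ hT))
  have h1 := mul_le_mul_of_nonneg_left hBcard (Nat.cast_nonneg (α := ℝ) M)
  have h2 := mul_le_mul_of_nonneg_right hδε (Nat.cast_nonneg (α := ℝ) A.card)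
  linarith

end Integers

section SlowGrowth

/-- A function of polynomial growth has, at some bounded scale, bounded doubling and small
increments. -/
lemma exists_slow_growth (C d : ℕ) {η : ℝ} (hη : 0 < η) :
    ∃ J : ℕ, ∀ (f : ℕ → ℕ) (a : ℕ), Monotone f → 0 < a → a ≤ f 1 →
      (∀ n, f n ≤ C * (n + 1) ^ d * a) →
      ∃ j ≤ J, f (2 * j) ≤ 4 ^ (d + 1) * f j ∧ (f (j + 1) : ℝ) ≤ (1 + η) * f j := by
  obtain ⟨n₀, hn₀⟩ := exists_nat_ge ((4 : ℝ) ^ (d + 1) / η)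
  have hn₀' : (4 : ℝ) ^ (d + 1) ≤ n₀ * η := (div_le_iff₀ hη).1 hn₀
  have hpos : 1 ≤ n₀ := by
    rcases Nat.eq_zero_or_pos n₀ with h | h
    · rw [h] at hn₀'
      have : (0 : ℝ) < 4 ^ (d + 1) := by positivity
      simp at hn₀'
      linarith
    · exact h
  set I := C * (2 * n₀) ^ d
  refine ⟨2 * (4 ^ I * n₀), fun f a hf ha ha1 hC => ?_⟩
  have hscale : ∃ i < I, f (4 ^ (i + 1) * n₀) ≤ 4 ^ (d + 1) * f (4 ^ i * n₀) := by
    by_contra! hcon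
    have hind : ∀ i ≤ I, (4 ^ (d + 1)) ^ i * a ≤ f (4 ^ i * n₀) := by
      intro i
      induction i with
      | zero =>
        intro _
        simpa using ha1.trans (hf hpos)
      | succ i ih =>
        intro hi
        calc (4 ^ (d + 1)) ^ (i + 1) * a = 4 ^ (d + 1) * ((4 ^ (d + 1)) ^ i * a) := by ring
          _ ≤ 4 ^ (d + 1) * f (4 ^ i * n₀) := Nat.mul_le_mul_left _ (ih (by omega))
          _ ≤ _ := (hcon i (by omega)).le
    have h1 := (hind I le_rfl).trans (hC _)
    have h2 : 4 ^ I * n₀ + 1 ≤ 4 ^ I * (2 * n₀) := by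
      have : 1 ≤ 4 ^ I * n₀ := Nat.mul_pos (by positivity) hpos
      linarith
    have h3 : (4 ^ (d + 1)) ^ I * a ≤ I * (4 ^ I) ^ d * a := by
      calc _ ≤ _ := h1
        _ ≤ C * (4 ^ I * (2 * n₀)) ^ d * a := by gcongr
        _ = I * (4 ^ I) ^ d * a := by rw [mul_pow]; ring
    have h4 : (4 ^ (d + 1)) ^ I = 4 ^ I * (4 ^ I) ^ d := by
      rw [← pow_mul, ← pow_mul, ← pow_add]
      ring_nf
    rw [h4] at h3
    have h5 := Nat.le_of_mul_le_mul_right (Nat.le_of_mul_le_mul_right h3 ha) (by positivity)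
    exact absurd h5 (not_le.2 (Nat.lt_pow_self (by norm_num)))
  obtain ⟨i, hi, hdoubling⟩ := hscale
  set n := 4 ^ i * n₀
  have hn4 : 4 ^ (i + 1) * n₀ = 4 * n := by rw [pow_succ']; ring
  rw [hn4] at hdoubling
  have hnn : n₀ ≤ n := Nat.le_mul_of_pos_left _ (by positivity)
  have hfpos : 0 < f n := lt_of_lt_of_le ha (ha1.trans (hf (hpos.trans hnn)))
  have hstep : ∃ j < n, (f (n + j + 1) : ℝ) ≤ (1 + η) * f (n + j) := by
    by_contra! hcon
    have hind : ∀ j ≤ n, (1 + j * η) * f n ≤ (f (n + j) : ℝ) := by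
      intro j
      induction j with
      | zero => intro _; simp
      | succ j ih =>
        intro hj
        have h1 := ih (by omega)
        have h2 := hcon j (by omega)
        have h3 : (f n : ℝ) ≤ f (n + j) := by exact_mod_cast hf (Nat.le_add_right n j)
        have h4 := mul_le_mul_of_nonneg_left h3 hη.le
        rw [← add_assoc]
        push_cast
        linarith
    have h1 := hind n le_rfl
    have h2 : (f (n + n) : ℝ) ≤ 4 ^ (d + 1) * f n := by
      exact_mod_cast (hf (show n + n ≤ 4 * n by omega)).trans hdoubling
    have h3 : (0 : ℝ) < f n := by exact_mod_cast hfpos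
    have h4 : (1 + n * η : ℝ) ≤ 4 ^ (d + 1) := le_of_mul_le_mul_right (h1.trans h2) h3
    have h5 : (n₀ : ℝ) * η ≤ n * η := by gcongr
    linarith
  obtain ⟨j, hj, hjη⟩ := hstep
  have hnI : n ≤ 4 ^ I * n₀ :=
    Nat.mul_le_mul_right _ (Nat.pow_le_pow_right (by norm_num) hi.le)
  refine ⟨n + j, by omega, ?_, hjη⟩
  calc f (2 * (n + j)) ≤ f (4 * n) := hf (by omega)
    _ ≤ _ := hdoubling
    _ ≤ _ := Nat.mul_le_mul_left _ (hf (Nat.le_add_right n j))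

end SlowGrowth

section LargeSpectrum

variable {p : ℕ} [NeZero p]

/-- The exponential sum of a set of residues modulo `p`. -/
noncomputable def expSum (S : Finset (ZMod p)) (t : ZMod p) : ℂ :=
  ∑ x ∈ S, ZMod.stdAddChar (t * x)

lemma norm_expSum_le (S : Finset (ZMod p)) (t : ZMod p) : ‖expSum S t‖ ≤ S.card := by
  refine (norm_sum_le _ _).trans ?_
  simp [AddChar.norm_apply]

lemma star_expSum (S : Finset (ZMod p)) (t : ZMod p) :
    (starRingEnd ℂ) (expSum S t) = ∑ x ∈ S, ZMod.stdAddChar (t * (-x)) := by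
  rw [expSum, map_sum]
  refine Finset.sum_congr rfl fun x _ => ?_
  rw [mul_neg, AddChar.map_neg_eq_conj]

lemma sum_stdAddChar_mul (b : ZMod p) :
    ∑ t : ZMod p, ZMod.stdAddChar (t * b) = if b = 0 then (p : ℂ) else 0 := by
  rw [AddChar.sum_mulShift b (ZMod.isPrimitive_stdAddChar p), ZMod.card]
  split_ifs <;> simp

lemma sum_norm_expSum_sq (S : Finset (ZMod p)) : ∑ t, ‖expSum S t‖ ^ 2 = (p : ℝ) * S.card := by
  have h : ∑ t, expSum S t * (starRingEnd ℂ) (expSum S t) = (p : ℂ) * S.card := by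
    calc ∑ t, expSum S t * (starRingEnd ℂ) (expSum S t)
        = ∑ t, ∑ x ∈ S, ∑ y ∈ S, (ZMod.stdAddChar (t * (x - y)) : ℂ) := by
          refine Finset.sum_congr rfl fun t _ => ?_
          rw [star_expSum, expSum, Finset.sum_mul_sum]
          refine Finset.sum_congr rfl fun x _ => Finset.sum_congr rfl fun y _ => ?_
          rw [← AddChar.map_add_eq_mul]
          ring_nf
      _ = ∑ x ∈ S, ∑ y ∈ S, ∑ t, (ZMod.stdAddChar (t * (x - y)) : ℂ) := by
          rw [Finset.sum_comm]
          exact Finset.sum_congr rfl fun x _ => Finset.sum_comm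
      _ = ∑ x ∈ S, (p : ℂ) := by
          refine Finset.sum_congr rfl fun x hx => ?_
          simp_rw [sum_stdAddChar_mul, sub_eq_zero]
          rw [Finset.sum_ite_eq, if_pos hx]
      _ = _ := by rw [Finset.sum_const, nsmul_eq_mul, mul_comm]
  simp_rw [Complex.mul_conj'] at h
  exact_mod_cast h

lemma sum_expSum_mul_expSum {B C : Finset (ZMod p)} (h : B + B ⊆ C) :
    ∑ t, expSum B t * expSum B t * (starRingEnd ℂ) (expSum C t) = (p : ℂ) * B.card ^ 2 := by
  calc ∑ t, expSum B t * expSum B t * (starRingEnd ℂ) (expSum C t)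
      = ∑ t, ∑ x ∈ B, ∑ y ∈ B, ∑ z ∈ C, (ZMod.stdAddChar (t * (x + y - z)) : ℂ) := by
        refine Finset.sum_congr rfl fun t _ => ?_
        rw [star_expSum, expSum, Finset.sum_mul_sum, Finset.sum_mul]
        refine Finset.sum_congr rfl fun x _ => ?_
        rw [Finset.sum_mul_sum]
        refine Finset.sum_congr rfl fun y _ => Finset.sum_congr rfl fun z _ => ?_
        rw [← AddChar.map_add_eq_mul, ← AddChar.map_add_eq_mul]
        ring_nf
    _ = ∑ x ∈ B, ∑ y ∈ B, ∑ z ∈ C, ∑ t, (ZMod.stdAddChar (t * (x + y - z)) : ℂ) := by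
        rw [Finset.sum_comm]
        refine Finset.sum_congr rfl fun x _ => ?_
        rw [Finset.sum_comm]
        exact Finset.sum_congr rfl fun y _ => Finset.sum_comm
    _ = ∑ x ∈ B, ∑ y ∈ B, (p : ℂ) := by
        refine Finset.sum_congr rfl fun x hx => Finset.sum_congr rfl fun y hy => ?_
        simp_rw [sum_stdAddChar_mul, sub_eq_zero]
        rw [Finset.sum_ite_eq, if_pos (h (Finset.add_mem_add hx hy))]
    _ = _ := by
        simp only [Finset.sum_const, nsmul_eq_mul]
        ring

/-- A sparse set with small doubling has a large nontrivial Fourier coefficient. -/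
lemma exists_large_expSum {B C : Finset (ZMod p)} (h : B + B ⊆ C) (hB : B.Nonempty) {K : ℝ}
    (hK : (C.card : ℝ) ≤ K * B.card) (hC : 4 * C.card ≤ p) :
    ∃ t ≠ 0, B.card ≤ (1 + K) * ‖expSum B t‖ := by
  by_contra! hcon
  have hp : (0 : ℝ) < p := by exact_mod_cast NeZero.pos p
  have hBpos : (0 : ℝ) < B.card := by exact_mod_cast hB.card_pos
  have hK0 : 0 ≤ K := by
    by_contra! hneg
    have : (0 : ℝ) ≤ C.card := by positivity
    nlinarith
  have h1 : (p : ℝ) * B.card ^ 2 ≤ ∑ t, ‖expSum B t‖ * ‖expSum B t‖ * ‖expSum C t‖ := by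
    have := norm_sum_le Finset.univ
      fun t => expSum B t * expSum B t * (starRingEnd ℂ) (expSum C t)
    rw [sum_expSum_mul_expSum h] at this
    simpa using this
  have h2 : ∀ t, ‖expSum B t‖ * ‖expSum B t‖ * ‖expSum C t‖ ≤
      (if t = 0 then (B.card : ℝ) ^ 2 * C.card else 0) +
        B.card / (1 + K) * ((‖expSum B t‖ ^ 2 + ‖expSum C t‖ ^ 2) / 2) := by
    intro t
    split_ifs with ht
    · have h3 : ‖expSum B t‖ * ‖expSum B t‖ * ‖expSum C t‖ ≤ B.card * B.card * C.card := by
        gcongr <;> exact norm_expSum_le _ _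
      have h4 : 0 ≤ B.card / (1 + K) * ((‖expSum B t‖ ^ 2 + ‖expSum C t‖ ^ 2) / 2) := by
        positivity
      nlinarith
    · have h3 : ‖expSum B t‖ ≤ B.card / (1 + K) := by
        rw [le_div_iff₀ (by linarith), mul_comm]
        exact (hcon t ht).le
      rw [zero_add, mul_assoc]
      refine mul_le_mul h3 ?_ (by positivity) (by positivity)
      nlinarith [sq_nonneg (‖expSum B t‖ - ‖expSum C t‖)]
  have h3 := h1.trans (Finset.sum_le_sum fun t _ => h2 t)
  rw [Finset.sum_add_distrib, Finset.sum_ite_eq' Finset.univ, if_pos (Finset.mem_univ _),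
    ← Finset.mul_sum, ← Finset.sum_div, Finset.sum_add_distrib, sum_norm_expSum_sq,
    sum_norm_expSum_sq] at h3
  have h4 : B.card / (1 + K) * ((p * B.card + p * C.card) / 2) ≤ p * (B.card : ℝ) ^ 2 / 2 := by
    rw [div_mul_eq_mul_div, div_le_iff₀ (by linarith)]
    have := mul_le_mul_of_nonneg_left hK (show (0 : ℝ) ≤ p * B.card / 2 by positivity)
    nlinarith
  have h5 : (B.card : ℝ) ^ 2 * C.card ≤ (B.card : ℝ) ^ 2 * (p / 4) := by
    have : (4 * C.card : ℝ) ≤ p := by exact_mod_cast hC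
    gcongr
    linarith
  have h6 : (0 : ℝ) < p * B.card ^ 2 := by positivity
  linarith

lemma norm_expSum_sub_le {S T : Finset (ZMod p)} (h : S ⊆ T) (t : ZMod p) :
    ‖expSum T t - expSum S t‖ ≤ (T.card : ℝ) - S.card := by
  have h1 : expSum T t - expSum S t = expSum (T \ S) t := by
    rw [sub_eq_iff_eq_add]
    exact (Finset.sum_sdiff h).symm
  rw [h1]
  refine (norm_expSum_le _ _).trans ?_
  rw [Finset.card_sdiff_of_subset h, Nat.cast_sub (Finset.card_le_card h)]

/-- If `B` and `B + d` are contained in a set slightly larger than `B`, the characters with large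
Fourier coefficient on `B` are almost trivial at `d`. -/
lemma norm_stdAddChar_sub_one_mul_le {B T : Finset (ZMod p)} {d : ZMod p} (hB : B ⊆ T)
    (hd : ∀ b ∈ B, b + d ∈ T) (t : ZMod p) :
    ‖(ZMod.stdAddChar (t * d) : ℂ) - 1‖ * ‖expSum B t‖ ≤ 2 * ((T.card : ℝ) - B.card) := by
  have hcard : (B.image fun b => b + d).card = B.card :=
    Finset.card_image_of_injective _ (add_left_injective d)
  have himg : expSum (B.image fun b => b + d) t = ZMod.stdAddChar (t * d) * expSum B t := by
    rw [expSum, Finset.sum_image (add_left_injective d).injOn, expSum, Finset.mul_sum]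
    refine Finset.sum_congr rfl fun b _ => ?_
    rw [← AddChar.map_add_eq_mul]
    ring_nf
  have h1 := norm_expSum_sub_le hB t
  have h2 := norm_expSum_sub_le (Finset.image_subset_iff.2 hd) t
  rw [hcard, himg] at h2
  rw [← norm_mul]
  calc _ = ‖(expSum T t - expSum B t) - (expSum T t - ZMod.stdAddChar (t * d) * expSum B t)‖ := by
        congr 1
        ring
    _ ≤ _ := norm_sub_le _ _
    _ ≤ _ := by linarith

lemma abs_valMinAbs_le (x : ZMod p) :
    4 * |(x.valMinAbs : ℝ)| ≤ ‖(ZMod.stdAddChar x : ℂ) - 1‖ * p := by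
  have hp : (0 : ℝ) < p := by exact_mod_cast NeZero.pos p
  set v := x.valMinAbs with hv
  have hx : ZMod.stdAddChar x = Complex.exp (Complex.I * ((2 * Real.pi * v / p : ℝ) : ℂ)) := by
    conv_lhs => rw [← x.coe_valMinAbs, ← hv]
    rw [ZMod.stdAddChar_coe]
    congr 1
    push_cast
    ring
  have hvp : 2 * |(v : ℝ)| ≤ p := by
    have h1 := x.valMinAbs_mem_Ioc
    rw [← hv] at h1
    have h2 : (-p : ℝ) < v * 2 := by exact_mod_cast h1.1
    have h3 : (v : ℝ) * 2 ≤ p := by exact_mod_cast h1.2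
    rcases abs_cases (v : ℝ) with h | h <;> linarith [h.1]
  have habs : |2 * Real.pi * v / p / 2| = Real.pi * |(v : ℝ)| / p := by
    rw [abs_div, abs_div, abs_mul, abs_mul, abs_of_pos Real.pi_pos, abs_of_pos hp]
    simp only [Nat.abs_ofNat]
    ring
  have h := Real.mul_abs_le_abs_sin (x := 2 * Real.pi * v / p / 2) (by
    rw [habs, div_le_iff₀ hp]
    nlinarith [Real.pi_pos])
  rw [hx, Complex.norm_exp_I_mul_ofReal_sub_one, norm_mul, Real.norm_eq_abs, Real.norm_eq_abs,
    abs_of_pos (show (0 : ℝ) < 2 by norm_num)]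
  rw [habs] at h
  have h2 : 2 / Real.pi * (Real.pi * |(v : ℝ)| / p) = 2 * |(v : ℝ)| / p := by
    field_simp
  rw [h2, div_le_iff₀ hp] at h
  linarith

end LargeSpectrum

section Rectification

/-- A sparse set with small doubling has a dilate whose differences are close to zero. -/
lemma exists_dilate_near_zero (K : ℕ) {κ : ℝ} (hκ : 0 < κ) :
    ∃ α : ℝ, 0 < α ∧ ∀ (p : ℕ) [NeZero p] (A : Finset (ZMod p)), A.Nonempty →
      (A - A).card ≤ K * A.card → (A.card : ℝ) ≤ α * p →
      ∃ t : ZMod p, t ≠ 0 ∧ ∀ d ∈ A - A, |((t * d).valMinAbs : ℝ)| ≤ κ * p := by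
  set L : ℝ := 4 ^ (K ^ 5 + 1) with hL
  have hLpos : 0 < 1 + L := by positivity
  set η : ℝ := 2 * κ / (1 + L) with hη
  obtain ⟨J, hJ⟩ := exists_slow_growth K (K ^ 5) (η := η) (by positivity)
  set c : ℝ := K * (2 * J + 1) ^ K ^ 5 with hc
  refine ⟨1 / (4 * (c + 1)), by positivity, fun p _ A hA hK hα => ?_⟩
  have hp : (0 : ℝ) < p := by exact_mod_cast NeZero.pos p
  obtain ⟨a₀, ha₀⟩ := hA
  have h0 : (0 : ZMod p) ∈ A - A := by simpa using Finset.sub_mem_sub ha₀ ha₀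
  have hgrowth := card_iteratedSumset_sub_le ⟨a₀, ha₀⟩ hK
  obtain ⟨j, hjJ, hj2, hj1⟩ := hJ (fun n => (iteratedSumset (A - A) n).card) A.card
    (fun _ _ h => Finset.card_le_card (iteratedSumset_mono h0 h)) (Finset.card_pos.2 ⟨a₀, ha₀⟩)
    (by
      refine Finset.card_le_card_of_injOn (fun a => a - a₀) ?_ sub_left_injective.injOn
      intro a ha
      rw [iteratedSumset, iteratedSumset, Finset.singleton_zero, zero_add]
      exact Finset.mem_coe.2 (Finset.sub_mem_sub ha ha₀)) hgrowth
  have hBpos : (0 : ℝ) < (iteratedSumset (A - A) j).card := by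
    exact_mod_cast Finset.card_pos.2 ⟨0, zero_mem_iteratedSumset h0 j⟩
  have hsparse : 4 * (iteratedSumset (A - A) (2 * j)).card ≤ p := by
    have h1 : ((iteratedSumset (A - A) (2 * j)).card : ℝ) ≤ K * (2 * j + 1) ^ K ^ 5 * A.card := by
      exact_mod_cast hgrowth (2 * j)
    have h2 : (K * (2 * j + 1) ^ K ^ 5 * A.card : ℝ) ≤ c * A.card := by
      have : (j : ℝ) ≤ J := by exact_mod_cast hjJ
      rw [hc]
      gcongr
    have h3 : c * A.card ≤ c * (1 / (4 * (c + 1)) * p) := by gcongr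
    have h4 : c * (1 / (4 * (c + 1)) * p) ≤ p / 4 := by
      have hc0 : 0 ≤ c := by positivity
      rw [show c * (1 / (4 * (c + 1)) * p) = c / (c + 1) * (p / 4) by field_simp]
      refine mul_le_of_le_one_left (by positivity) ?_
      rw [div_le_one (by positivity)]
      linarith
    have h5 : (4 * (iteratedSumset (A - A) (2 * j)).card : ℝ) ≤ p := by linarith
    exact_mod_cast h5
  obtain ⟨t, ht0, ht⟩ := exists_large_expSum (B := iteratedSumset (A - A) j)
    (C := iteratedSumset (A - A) (2 * j)) (K := L)
    (by rw [two_mul, iteratedSumset_add]) ⟨0, zero_mem_iteratedSumset h0 j⟩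
    (by rw [hL]; exact_mod_cast hj2) hsparse
  refine ⟨t, ht0, fun d hd => ?_⟩
  have h1 := norm_stdAddChar_sub_one_mul_le (iteratedSumset_mono h0 (Nat.le_succ j))
    (fun b hb => Finset.add_mem_add hb hd) t
  have h2 := abs_valMinAbs_le (t * d)
  set F := ‖expSum (iteratedSumset (A - A) j) t‖
  set Z := ‖(ZMod.stdAddChar (t * d) : ℂ) - 1‖
  have hF : 0 < F := pos_of_mul_pos_right (hBpos.trans_le ht) hLpos.le
  have h3 : Z * F ≤ 4 * κ * F := by
    have h4 : η * (iteratedSumset (A - A) j).card ≤ η * ((1 + L) * F) := by gcongr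
    have h5 : η * ((1 + L) * F) = 2 * κ * F := by rw [hη]; field_simp
    have hj1' : ((iteratedSumset (A - A) (j + 1)).card : ℝ) ≤
      (1 + η) * (iteratedSumset (A - A) j).card := hj1
    rw [Nat.succ_eq_add_one] at h1
    linarith
  have h4 : Z ≤ 4 * κ := le_of_mul_le_mul_right h3 hF
  have h5 : Z * p ≤ 4 * κ * p := by gcongr
  linarith

lemma intCast_injOn {p : ℕ} {S : Set ℤ} (hS : ∀ x ∈ S, 2 * |x| < p) :
    Set.InjOn (Int.cast : ℤ → ZMod p) S := by
  intro x hx y hy hxy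
  have h1 := (ZMod.intCast_eq_intCast_iff_dvd_sub _ _ _).1 hxy
  have h2 := hS x hx
  have h3 := hS y hy
  have h4 : |y - x| < p := by
    have := abs_sub y x
    linarith
  have h5 := Int.eq_zero_of_abs_lt_dvd h1 h4
  linarith

/-- A set of residues with a dilate concentrated near zero can be replaced by a set of integers
without enlarging its difference set or its sum of dilates. -/
lemma exists_int_model {p : ℕ} [NeZero p] {k : ℕ} (l : Fin k → ℤ) {A : Finset (ZMod p)}
    (hA : A.Nonempty) {t : ZMod p} (ht : IsUnit t)
    (h : ∀ d ∈ A - A, 4 * (∑ i, |l i| + 1) * |(t * d).valMinAbs| < p) :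
    ∃ A' : Finset ℤ, A'.card = A.card ∧ (A' - A').card ≤ (A - A).card ∧
      (∑ i, A'.image fun a => l i • a).card ≤ (∑ i, A.image fun a => l i • a).card := by
  classical
  obtain ⟨a₀, ha₀⟩ := hA
  set M := ∑ i, |l i| with hM
  have hM0 : 0 ≤ M := Finset.sum_nonneg fun i _ => abs_nonneg _
  let v : ZMod p → ℤ := fun a => (t * (a - a₀)).valMinAbs
  have hv : ∀ a, ((v a : ℤ) : ZMod p) = t * (a - a₀) := fun a => ZMod.coe_valMinAbs _
  have hvinj : Function.Injective v := fun a b hab => by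
    have := ht.mul_left_cancel (ZMod.injective_valMinAbs hab)
    exact sub_left_injective this
  have hvle : ∀ a ∈ A, 4 * (M + 1) * |v a| < p := fun a ha => h _ (Finset.sub_mem_sub ha ha₀)
  refine ⟨A.image v, Finset.card_image_of_injective _ hvinj, ?_, ?_⟩
  · refine le_trans (Finset.card_le_card_of_injOn (Int.cast : ℤ → ZMod p)
      (t := (A - A).image fun d => t * d) ?_ ?_) Finset.card_image_le
    · intro x hx
      obtain ⟨y, hy, z, hz, rfl⟩ := Finset.mem_sub.1 (Finset.mem_coe.1 hx)
      obtain ⟨a, ha, rfl⟩ := Finset.mem_image.1 hy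
      obtain ⟨b, hb, rfl⟩ := Finset.mem_image.1 hz
      refine Finset.mem_coe.2 (Finset.mem_image.2 ⟨a - b, Finset.sub_mem_sub ha hb, ?_⟩)
      push_cast
      rw [hv, hv]
      ring
    · refine intCast_injOn fun x hx => ?_
      obtain ⟨y, hy, z, hz, rfl⟩ := Finset.mem_sub.1 (Finset.mem_coe.1 hx)
      obtain ⟨a, ha, rfl⟩ := Finset.mem_image.1 hy
      obtain ⟨b, hb, rfl⟩ := Finset.mem_image.1 hz
      have h1 := hvle a ha
      have h2 := hvle b hb
      have h3 := abs_sub (v a) (v b)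
      have h4 := mul_nonneg hM0 (abs_nonneg (v a))
      have h5 := mul_nonneg hM0 (abs_nonneg (v b))
      linarith
  · refine le_trans (Finset.card_le_card_of_injOn (Int.cast : ℤ → ZMod p)
      (t := (∑ i, A.image fun a => l i • a).image fun s => t * (s - ∑ i, l i • a₀)) ?_ ?_)
      Finset.card_image_le
    · intro x hx
      obtain ⟨f, hf, rfl⟩ := Finset.mem_sum_iff_exists.1 (Finset.mem_coe.1 hx)
      have hf' : ∀ i, ∃ a ∈ A, l i • v a = f i := fun i => by
        simpa using hf i (Finset.mem_univ i)
      choose a ha haf using hf'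
      refine Finset.mem_coe.2 (Finset.mem_image.2 ⟨∑ i, l i • a i,
        Finset.mem_sum_iff_exists.2 ⟨_, fun i _ => Finset.mem_image_of_mem _ (ha i), rfl⟩, ?_⟩)
      rw [← Finset.sum_sub_distrib, Finset.mul_sum]
      push_cast
      refine Finset.sum_congr rfl fun i _ => ?_
      rw [← haf i]
      simp only [smul_eq_mul, zsmul_eq_mul]
      push_cast
      rw [hv]
      ring
    · refine intCast_injOn fun x hx => ?_
      obtain ⟨f, hf, rfl⟩ := Finset.mem_sum_iff_exists.1 (Finset.mem_coe.1 hx)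
      have hf' : ∀ i, ∃ a ∈ A, l i • v a = f i := fun i => by
        simpa using hf i (Finset.mem_univ i)
      choose a ha haf using hf'
      have h1 : 4 * (M + 1) * |∑ i, f i| ≤ M * p := by
        calc 4 * (M + 1) * |∑ i, f i| ≤ 4 * (M + 1) * ∑ i, |f i| := by
              gcongr
              exact Finset.abs_sum_le_sum_abs _ _
          _ = ∑ i, |l i| * (4 * (M + 1) * |v (a i)|) := by
              rw [Finset.mul_sum]
              refine Finset.sum_congr rfl fun i _ => ?_
              rw [← haf i, smul_eq_mul, abs_mul]
              ring
          _ ≤ ∑ i, |l i| * p := by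
              refine Finset.sum_le_sum fun i _ => ?_
              exact mul_le_mul_of_nonneg_left (hvle _ (ha i)).le (abs_nonneg _)
          _ = M * p := by rw [hM, Finset.sum_mul]
      have hp : (0 : ℤ) < p := by exact_mod_cast NeZero.pos p
      by_contra! hcon
      nlinarith

end Rectification

section Doubling

/-- A small sum of dilates forces small doubling. -/
lemma card_sub_mul_card_le_card_sum_dilates_sq {p : ℕ} [Fact p.Prime] {k : ℕ} (l : Fin k → ℤ)
    (hl : ∀ i, (l i : ZMod p) ≠ 0) {i j : Fin k} (hij : i ≠ j) {A : Finset (ZMod p)}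
    (hA : A.Nonempty) :
    (A - A).card * A.card ≤ (∑ i, A.image fun a => l i • a).card ^ 2 := by
  classical
  have hinj : ∀ i, Function.Injective fun a : ZMod p => l i • a := fun i a b hab => by
    simp only [zsmul_eq_mul] at hab
    exact mul_left_cancel₀ (hl i) hab
  set X := A.image fun a => l i • a with hX
  set Y := A.image fun a => l j • a with hY
  have hXX : (X - X).card = (A - A).card := by
    rw [← Finset.card_image_of_injective (A - A) (hinj i)]
    congr 1
    exact (Finset.image_image₂_distrib fun a b => smul_sub (l i) a b).symm
  have hYc : Y.card = A.card := Finset.card_image_of_injective _ (hinj j)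
  have hXY : (X + Y).card ≤ (∑ i, A.image fun a => l i • a).card := by
    rw [← Finset.add_sum_erase _ _ (Finset.mem_univ i),
      ← Finset.add_sum_erase _ _ (Finset.mem_erase.2 ⟨hij.symm, Finset.mem_univ j⟩), ← add_assoc]
    refine Finset.card_le_card_add_right ?_
    obtain ⟨a, ha⟩ := hA
    exact ⟨_, Finset.mem_sum_iff_exists.2
      ⟨_, fun i _ => Finset.mem_image_of_mem _ ha, rfl⟩⟩
  have h := Finset.ruzsa_triangle_inequality_sub_add_add X Y X
  rw [hXX, hYc] at h
  refine h.trans ?_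
  rw [sq]
  exact Nat.mul_le_mul hXY hXY

end Doubling

theorem sums_of_dilates_small_density (k : ℕ) (hk : 1 ≤ k) (l : Fin k → ℤ)
    (hl : ∀ i, l i ≠ 0) (hgcd : Finset.univ.gcd l = 1)
    (M : ℕ) (hM : (M : ℤ) = ∑ i, |l i|)
    (ε : ℝ) (hε : 0 < ε) :
    ∃ α : ℝ, 0 < α ∧ ∃ N : ℕ, ∀ p : ℕ, p.Prime →
      ∀ A : Finset (ZMod p), N ≤ A.card → (A.card : ℝ) ≤ α * p →
        ((M : ℝ) - ε) * A.card ≤ ((∑ i, A.image fun a => l i • a).card : ℝ) := by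
  rcases hk.eq_or_lt with rfl | hk
  · refine ⟨1, one_pos, 0, fun p _ A _ _ => ?_⟩
    have hM1 : (M : ℤ) = 1 := by
      rw [hM, ← hgcd]
      simp [Int.abs_eq_normalize, Finset.univ_unique]
    have h1 : (M : ℝ) = 1 := by exact_mod_cast hM1
    have h2 : (A.card : ℝ) ≤ (∑ i, A.image fun a => l i • a).card := by
      exact_mod_cast card_le_card_sum_dilates l hgcd A
    rw [h1]
    have := mul_nonneg hε.le (Nat.cast_nonneg (α := ℝ) A.card)
    linarith
  have hM' : M = ∑ i, (l i).natAbs := by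
    zify
    exact hM
  obtain ⟨N, hN⟩ := exists_le_card_sum_dilates_int l hl hgcd (M ^ 2) hε
  obtain ⟨α, hα, hnear⟩ := exists_dilate_near_zero (M ^ 2)
    (κ := 1 / (8 * (M + 1))) (by positivity)
  refine ⟨min α 1, lt_min hα one_pos, max N (M + 1), fun p hp A hNA hAα => ?_⟩
  have : Fact p.Prime := ⟨hp⟩
  have hp0 : (0 : ℝ) < p := by exact_mod_cast hp.pos
  have hAcard : M + 1 ≤ A.card := (le_max_right _ _).trans hNA
  have hA : A.Nonempty := Finset.card_pos.1 (by omega)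
  have hMp : M < p := by
    have h1 : (A.card : ℝ) ≤ 1 * p := hAα.trans (by gcongr; exact min_le_right _ _)
    rw [one_mul] at h1
    have h2 : A.card ≤ p := by exact_mod_cast h1
    omega
  have hlp : ∀ i, (l i : ZMod p) ≠ 0 := by
    intro i h
    have h1 := (ZMod.intCast_zmod_eq_zero_iff_dvd _ _).1 h
    have h2 : |l i| ≤ M := by
      rw [hM]
      exact Finset.single_le_sum (f := fun i => |l i|) (fun i _ => abs_nonneg _)
        (Finset.mem_univ i)
    exact hl i (Int.eq_zero_of_abs_lt_dvd h1 (by omega))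
  by_contra! hcon
  have hdoubling : (A - A).card ≤ M ^ 2 * A.card := by
    have h1 := card_sub_mul_card_le_card_sum_dilates_sq l hlp
      (i := ⟨0, by omega⟩) (j := ⟨1, hk⟩) (by simp) hA
    have h2 : (∑ i, A.image fun a => l i • a).card ≤ M * A.card := by
      have h3 : ((∑ i, A.image fun a => l i • a).card : ℝ) ≤ M * A.card :=
        hcon.le.trans (by gcongr; linarith)
      exact_mod_cast h3
    refine Nat.le_of_mul_le_mul_right ?_ hA.card_pos
    calc _ ≤ _ := h1
      _ ≤ (M * A.card) ^ 2 := Nat.pow_le_pow_left h2 2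
      _ = _ := by ring
  obtain ⟨t, ht, htA⟩ := hnear p A hA hdoubling (hAα.trans (by gcongr; exact min_le_left _ _))
  obtain ⟨A', hcard, hsub, hsum⟩ := exists_int_model l hA ht.isUnit (fun d hd => by
    have h1 := htA d hd
    rw [div_mul_eq_mul_div, one_mul, le_div_iff₀ (by positivity)] at h1
    have h2 : 4 * ((M : ℝ) + 1) * |((t * d).valMinAbs : ℝ)| < p := by linarith
    rw [← hM]
    exact_mod_cast h2)
  have h1 := hN A' (by rw [hcard]; exact (le_max_left _ _).trans hNA)
    (by rw [hcard]; exact hsub.trans hdoubling)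
  rw [← hM', hcard] at h1
  have h2 : ((∑ i, A'.image fun a => l i • a).card : ℝ) ≤ (∑ i, A.image fun a => l i • a).card := by
    exact_mod_cast hsum
  linarith
end

section
/- Let λ₁, …, λ_k be nonzero integers whose greatest common divisor is 1, and set M = |λ₁| + … + |λ_k|. For every ε > 0 there exists N such that the following holds for every prime p: if A ⊆ ℤ/pℤ has diameter l(A) < p/M and |A| ≥ N, then |λ₁·A + λ₂·A + … + λ_k·A| ≥ (M − ε)·|A|. -/
open Pointwise

/-- The diameter `l(A)` of a subset `A ⊆ ℤ/pℤ`: the smallest `l` such that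
`A ⊆ {x, x + d, …, x + (l-1)d}` for some `x, d ∈ ℤ/pℤ`, i.e. the length of the
shortest arithmetic progression containing `A`. -/
noncomputable def apDiameter {p : ℕ} (A : Finset (ZMod p)) : ℕ :=
  sInf {l : ℕ | ∃ x d : ZMod p, ∀ a ∈ A, ∃ j : ℕ, j < l ∧ a = x + j • d}

/-- The sum of dilates `∑ i ∈ s, l i • A i`. -/
def dilateSum {ι G : Type*} [AddCommGroup G] [DecidableEq G] (s : Finset ι) (l : ι → ℤ)
    (A : ι → Finset G) : Finset G :=
  ∑ i ∈ s, (A i).image fun a => l i • a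

section General

variable {ι G : Type*} [AddCommGroup G] [DecidableEq G]

lemma dilateSum_insert [DecidableEq ι] {s : Finset ι} {j : ι} (hj : j ∉ s) (l : ι → ℤ)
    (A : ι → Finset G) :
    dilateSum (insert j s) l A = (A j).image (fun a => l j • a) + dilateSum s l A := by
  simp [dilateSum, Finset.sum_insert hj]

lemma mem_dilateSum {s : Finset ι} {l : ι → ℤ} {A : ι → Finset G} {x : G} :
    x ∈ dilateSum s l A ↔ ∃ f : ι → G, (∀ i ∈ s, f i ∈ A i) ∧ ∑ i ∈ s, l i • f i = x := by
  classical
  induction s using Finset.induction_on generalizing x with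
  | empty => simp [dilateSum, eq_comm]
  | insert j s hj ih =>
    rw [dilateSum_insert hj, Finset.mem_add]
    constructor
    · rintro ⟨y, hy, z, hz, rfl⟩
      obtain ⟨a, ha, rfl⟩ := Finset.mem_image.1 hy
      obtain ⟨f, hf, rfl⟩ := ih.1 hz
      have hne : ∀ i ∈ s, i ≠ j := fun i hi h => hj (h ▸ hi)
      refine ⟨Function.update f j a, fun i hi => ?_, ?_⟩
      · rcases Finset.mem_insert.1 hi with rfl | hi
        · simpa using ha
        · simpa [Function.update_of_ne (hne i hi)] using hf i hi
      · rw [Finset.sum_insert hj, Function.update_self]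
        congr 1
        exact Finset.sum_congr rfl fun i hi => by rw [Function.update_of_ne (hne i hi)]
    · rintro ⟨f, hf, rfl⟩
      rw [Finset.sum_insert hj]
      exact ⟨_, Finset.mem_image_of_mem _ (hf j (Finset.mem_insert_self j s)), _,
        ih.2 ⟨f, fun i hi => hf i (Finset.mem_insert_of_mem hi), rfl⟩, rfl⟩

lemma dilateSum_mono {s : Finset ι} {l : ι → ℤ} {A B : ι → Finset G}
    (h : ∀ i ∈ s, A i ⊆ B i) : dilateSum s l A ⊆ dilateSum s l B := by
  intro x hx
  obtain ⟨f, hf, rfl⟩ := mem_dilateSum.1 hx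
  exact mem_dilateSum.2 ⟨f, fun i hi => h i hi (hf i hi), rfl⟩

lemma card_dilateSum_le_pow (s : Finset ι) (l : ι → ℤ) (R : Finset G) :
    (dilateSum s l fun _ => R).card ≤ R.card ^ s.card := by
  classical
  induction s using Finset.induction_on with
  | empty => simp [dilateSum]
  | insert j s hj ih =>
    rw [dilateSum_insert hj, Finset.card_insert_of_notMem hj, pow_succ']
    exact Finset.card_add_le.trans (Nat.mul_le_mul Finset.card_image_le ih)

/-- If `K i` is a family of subgroups such that multiplication by `l i` is injective modulo `K i`,
and the classes modulo all the `K i` separate the points of `R`, then the sum of the dilates of `R`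
is at least as large as `R`. -/
lemma card_le_card_dilateSum_of_separating (l : ι → ℤ) (K : ι → AddSubgroup G)
    (hK : ∀ i x, l i • x ∈ K i → x ∈ K i) (s : Finset ι) (R : Finset G)
    (hR : ∀ x ∈ R, ∀ y ∈ R, (∀ i ∈ s, x - y ∈ K i) → x = y) :
    R.card ≤ (dilateSum s l fun _ => R).card := by
  classical
  induction s using Finset.induction_on generalizing R with
  | empty =>
    have : R.card ≤ 1 := Finset.card_le_one.2 fun x hx y hy => hR x hx y hy (by simp)
    simpa [dilateSum] using this
  | insert j s hj ih =>
    rcases R.eq_empty_or_nonempty with rfl | hne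
    · simp
    let q : G → G ⧸ K j := fun x => (x : G ⧸ K j)
    have hq : ∀ x y : G, q x = q y ↔ x - y ∈ K j := fun x y => by
      simp only [q]
      rw [eq_comm, QuotientAddGroup.eq, neg_add_eq_sub]
    obtain ⟨v, -, hv⟩ := Finset.exists_max_image (R.image q)
      (fun v => (R.filter fun x => q x = v).card) (hne.image q)
    set Rv := R.filter fun x => q x = v with hRv
    have hcard : R.card ≤ (R.image q).card * Rv.card := by
      rw [mul_comm]
      exact Finset.card_le_mul_card_image R Rv.card hv
    have hrep : ∀ u : R.image q, ∃ x ∈ R, q x = u := fun u => Finset.mem_image.1 u.2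
    choose r hrR hrq using hrep
    have hle : (R.image q).card * Rv.card
        ≤ ((Finset.univ : Finset (R.image q)) ×ˢ dilateSum s l fun _ => Rv).card := by
      rw [Finset.card_product, Finset.card_univ, Fintype.card_coe]
      refine Nat.mul_le_mul_left _ (ih Rv fun x hx y hy hxy => ?_)
      obtain ⟨hx, hxv⟩ := Finset.mem_filter.1 hx
      obtain ⟨hy, hyv⟩ := Finset.mem_filter.1 hy
      refine hR x hx y hy fun i hi => ?_
      rcases Finset.mem_insert.1 hi with rfl | hi
      · exact (hq x y).1 (hxv.trans hyv.symm)
      · exact hxy i hi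
    refine hcard.trans (hle.trans ?_)
    have hsingle : ∀ z ∈ dilateSum s l (fun _ => Rv), ∀ z' ∈ dilateSum s l (fun _ => Rv),
        z - z' ∈ K j := by
      intro z hz z' hz'
      obtain ⟨f, hf, rfl⟩ := mem_dilateSum.1 hz
      obtain ⟨f', hf', rfl⟩ := mem_dilateSum.1 hz'
      rw [← Finset.sum_sub_distrib]
      refine sum_mem fun i hi => ?_
      rw [← smul_sub]
      exact zsmul_mem ((hq _ _).1 ((Finset.mem_filter.1 (hf i hi)).2.trans
        (Finset.mem_filter.1 (hf' i hi)).2.symm)) _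
    refine Finset.card_le_card_of_injOn (fun x => l j • r x.1 + x.2) ?_ ?_
    · rintro ⟨u, z⟩ hz
      have hz := (Finset.mem_product.1 (Finset.mem_coe.1 hz)).2
      rw [dilateSum_insert hj, Finset.mem_coe]
      exact Finset.add_mem_add (Finset.mem_image_of_mem _ (hrR u))
        (dilateSum_mono (fun _ _ => Finset.filter_subset _ _) hz)
    · rintro ⟨u, z⟩ hz ⟨u', z'⟩ hz' h
      have hz := (Finset.mem_product.1 (Finset.mem_coe.1 hz)).2
      have hz' := (Finset.mem_product.1 (Finset.mem_coe.1 hz')).2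
      simp only at h hz hz'
      have h1 : l j • (r u - r u') = z' - z := by
        rw [smul_sub, sub_eq_sub_iff_add_eq_add, h, add_comm]
      have h2 : r u - r u' ∈ K j := hK j _ (h1 ▸ hsingle z' hz' z hz)
      have h3 : u = u' := Subtype.ext (by rw [← hrq u, ← hrq u']; exact (hq _ _).2 h2)
      subst h3
      simpa using h

/-- The sum of dilates with coprime coefficients is at least as large as the original set. -/
lemma card_le_card_dilateSum {s : Finset ι} {l : ι → ℤ} (hl : s.gcd l = 1) (R : Finset G) :
    R.card ≤ (dilateSum s l fun _ => R).card := by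
  let K : ι → AddSubgroup G := fun i =>
    { carrier := {x | ∃ n : ℕ, (l i) ^ n • x = 0}
      zero_mem' := ⟨0, by simp⟩
      add_mem' := by
        rintro x y ⟨m, hm⟩ ⟨n, hn⟩
        refine ⟨m + n, ?_⟩
        rw [smul_add, pow_add, mul_smul, mul_smul, smul_comm (l i ^ m) (l i ^ n) x, hm, hn]
        simp
      neg_mem' := by
        rintro x ⟨n, hn⟩
        exact ⟨n, by rw [smul_neg, hn, neg_zero]⟩ }
  refine card_le_card_dilateSum_of_separating l K ?_ s R ?_
  · rintro i x ⟨n, hn⟩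
    exact ⟨n + 1, by rw [pow_succ, mul_smul, hn]⟩
  · intro x _ y _ h
    rw [← sub_eq_zero, ← AddMonoid.addOrderOf_eq_one_iff]
    by_contra hne
    obtain ⟨p, hp, hdvd⟩ := Nat.exists_prime_and_dvd hne
    have : (p : ℤ) ∣ s.gcd l := Finset.dvd_gcd fun i hi => by
      obtain ⟨n, hn⟩ := h i hi
      exact Int.Prime.dvd_pow' hp ((Int.natCast_dvd_natCast.2 hdvd).trans
        (addOrderOf_dvd_iff_zsmul_eq_zero.2 hn))
    rw [hl] at this
    exact hp.one_lt.ne' (by exact_mod_cast Int.eq_one_of_dvd_one (by positivity) this)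

end General

/-- The set `X` meets every residue class modulo `Q`. -/
def MeetsAllClasses (Q : ℤ) (X : Finset ℤ) : Prop :=
  ∀ z : ℤ, ∃ x ∈ X, Q ∣ x - z

lemma MeetsAllClasses.of_dvd {Q q : ℤ} {X : Finset ℤ} (h : MeetsAllClasses Q X) (hq : q ∣ Q) :
    MeetsAllClasses q X := fun z =>
  let ⟨x, hx, hxz⟩ := h z
  ⟨x, hx, hq.trans hxz⟩

lemma MeetsAllClasses.nonempty {Q : ℤ} {X : Finset ℤ} (h : MeetsAllClasses Q X) : X.Nonempty :=
  let ⟨x, hx, _⟩ := h 0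
  ⟨x, hx⟩

/-- Lower bound for `a • X + q • Y` with `a`, `q` coprime, when `X` meets all classes modulo `q` and
`Y` meets all classes modulo `a`. -/
lemma card_add_dilates_ge {a q : ℤ} (ha : a ≠ 0) (hq : q ≠ 0) (haq : IsCoprime a q)
    {X Y : Finset ℤ} (hX : MeetsAllClasses q X) (hY : MeetsAllClasses a Y) :
    a.natAbs * X.card + q.natAbs * Y.card
      ≤ (X.image (a * ·) + Y.image (q * ·)).card + q.natAbs * a.natAbs := by
  classical
  have : NeZero q.natAbs := ⟨Int.natAbs_ne_zero.2 hq⟩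
  have : NeZero a.natAbs := ⟨Int.natAbs_ne_zero.2 ha⟩
  have hcast : ∀ (m x y : ℤ), ((x : ZMod m.natAbs) = y) ↔ m ∣ x - y := fun m x y => by
    rw [eq_comm, ZMod.intCast_eq_intCast_iff_dvd_sub, Int.natAbs_dvd]
  let Xf : ZMod q.natAbs → Finset ℤ := fun i => X.filter fun x : ℤ => (x : ZMod q.natAbs) = i
  let Yf : ZMod a.natAbs → Finset ℤ := fun c => Y.filter fun y : ℤ => (y : ZMod a.natAbs) = c
  have hXf : ∑ i, (Xf i).card = X.card :=
    (Finset.card_eq_sum_card_fiberwise fun _ _ => Finset.mem_coe.2 (Finset.mem_univ _)).symm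
  have hYf : ∑ c, (Yf c).card = Y.card :=
    (Finset.card_eq_sum_card_fiberwise fun _ _ => Finset.mem_coe.2 (Finset.mem_univ _)).symm
  have hXne : ∀ i, (Xf i).Nonempty := fun i => by
    obtain ⟨z, rfl⟩ := ZMod.intCast_surjective i
    obtain ⟨x, hx, hxz⟩ := hX z
    exact ⟨x, Finset.mem_filter.2 ⟨hx, (hcast q x z).2 hxz⟩⟩
  have hYne : ∀ c, (Yf c).Nonempty := fun c => by
    obtain ⟨z, rfl⟩ := ZMod.intCast_surjective c
    obtain ⟨y, hy, hyz⟩ := hY z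
    exact ⟨y, Finset.mem_filter.2 ⟨hy, (hcast a y z).2 hyz⟩⟩
  let T : ZMod q.natAbs × ZMod a.natAbs → Finset ℤ := fun e =>
    (Xf e.1).image (a * ·) + (Yf e.2).image (q * ·)
  have hT : ∀ e, (Xf e.1).card + (Yf e.2).card ≤ (T e).card + 1 := fun e => by
    have h := cauchy_davenport_add_of_linearOrder_isCancelAdd
      ((hXne e.1).image (a * ·)) ((hYne e.2).image (q * ·))
    rw [Finset.card_image_of_injective _ (mul_right_injective₀ ha),
      Finset.card_image_of_injective _ (mul_right_injective₀ hq)] at h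
    simp only [T]
    omega
  have hdisj : ((Finset.univ : Finset (ZMod q.natAbs × ZMod a.natAbs)) : Set _).PairwiseDisjoint
      T := by
    intro e _ e' _ hne
    refine Finset.disjoint_left.2 fun t ht ht' => hne ?_
    obtain ⟨_, hu, _, hv, rfl⟩ := Finset.mem_add.1 ht
    obtain ⟨x, hx, rfl⟩ := Finset.mem_image.1 hu
    obtain ⟨y, hy, rfl⟩ := Finset.mem_image.1 hv
    obtain ⟨_, hu', _, hv', h⟩ := Finset.mem_add.1 ht'
    obtain ⟨x', hx', rfl⟩ := Finset.mem_image.1 hu'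
    obtain ⟨y', hy', rfl⟩ := Finset.mem_image.1 hv'
    obtain ⟨-, hx⟩ := Finset.mem_filter.1 hx
    obtain ⟨-, hy⟩ := Finset.mem_filter.1 hy
    obtain ⟨-, hx'⟩ := Finset.mem_filter.1 hx'
    obtain ⟨-, hy'⟩ := Finset.mem_filter.1 hy'
    have h1 : q ∣ x - x' := haq.symm.dvd_of_dvd_mul_left ⟨y' - y, by linear_combination -h⟩
    have h2 : a ∣ y - y' := haq.dvd_of_dvd_mul_left ⟨x' - x, by linear_combination -h⟩
    exact Prod.ext (by rw [← hx, ← hx', hcast]; exact h1) (by rw [← hy, ← hy', hcast]; exact h2)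
  have hsub : Finset.univ.biUnion T ⊆ X.image (a * ·) + Y.image (q * ·) :=
    Finset.biUnion_subset.2 fun e _ => Finset.add_subset_add
      (Finset.image_subset_image (Finset.filter_subset _ _))
      (Finset.image_subset_image (Finset.filter_subset _ _))
  have hle := Finset.card_le_card hsub
  rw [Finset.card_biUnion hdisj] at hle
  have hsum := Finset.sum_le_sum fun e (_ : e ∈ Finset.univ) => hT e
  have hlhs : ∑ e : ZMod q.natAbs × ZMod a.natAbs, ((Xf e.1).card + (Yf e.2).card)
      = a.natAbs * X.card + q.natAbs * Y.card := by
    rw [Fintype.sum_prod_type]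
    simp only [Finset.sum_add_distrib, Finset.sum_const, Finset.card_univ, ZMod.card, hYf,
      smul_eq_mul, ← Finset.mul_sum, hXf]
  rw [hlhs, Finset.sum_add_distrib] at hsum
  simp only [Finset.sum_const, Finset.card_univ, Fintype.card_prod, ZMod.card, smul_eq_mul,
    mul_one] at hsum
  omega

lemma MeetsAllClasses.add_dilates {Q a q : ℤ} (haq : IsCoprime a q) {X Y : Finset ℤ}
    (hX : MeetsAllClasses Q X) (hY : MeetsAllClasses Q Y) :
    MeetsAllClasses Q (X.image (a * ·) + Y.image (q * ·)) := by
  intro z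
  obtain ⟨u, v, huv⟩ := haq
  obtain ⟨x, hx, m, hm⟩ := hX (u * z)
  obtain ⟨y, hy, n, hn⟩ := hY (v * z)
  exact ⟨a * x + q * y, Finset.add_mem_add (Finset.mem_image_of_mem _ hx)
    (Finset.mem_image_of_mem _ hy), a * m + q * n,
    by linear_combination a * hm + q * hn + z * huv⟩

/-- A sum of dilates of sets which meet all classes modulo `Q` is, up to the common divisor of the
coefficients, again such a set, and it has almost the largest conceivable guaranteed size. -/
lemma exists_dilateSum_eq_image {ι : Type*} {Q : ℤ} (hQ : Q ≠ 0) (l : ι → ℤ) (s : Finset ι)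
    (hl : ∀ i ∈ s, l i ≠ 0) (hlQ : ∀ i ∈ s, l i ∣ Q) :
    ∃ C : ℕ, ∀ A : ι → Finset ℤ, (∀ i ∈ s, MeetsAllClasses Q (A i)) →
      ∃ B : Finset ℤ, dilateSum s l A = B.image (s.gcd l * ·) ∧ MeetsAllClasses Q B ∧
        ∑ i ∈ s, (l i).natAbs * (A i).card ≤ (s.gcd l).natAbs * B.card + C := by
  classical
  induction s using Finset.induction_on with
  | empty =>
    refine ⟨0, fun A _ => ⟨Finset.Ico 0 |Q|, ?_, fun z => ?_, by simp⟩⟩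
    · ext x
      simp only [dilateSum, Finset.sum_empty, Finset.mem_zero, Finset.gcd_empty, zero_mul,
        Finset.mem_image, Finset.mem_Ico]
      exact ⟨fun h => ⟨0, ⟨le_rfl, abs_pos.2 hQ⟩, h.symm⟩, fun ⟨_, _, h⟩ => h.symm⟩
    · exact ⟨z % Q, Finset.mem_Ico.2 ⟨Int.emod_nonneg z hQ, Int.emod_lt_abs z hQ⟩,
        -(z / Q), by linear_combination Int.emod_add_mul_ediv z Q⟩
  | insert j s hj ih =>
    obtain ⟨C, hC⟩ := ih (fun i hi => hl i (Finset.mem_insert_of_mem hi))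
      (fun i hi => hlQ i (Finset.mem_insert_of_mem hi))
    have hlj := hl j (Finset.mem_insert_self j s)
    have hljQ := hlQ j (Finset.mem_insert_self j s)
    obtain ⟨a, q, ha, hq, hunit⟩ := extract_gcd (l j) (s.gcd l)
    have haq : IsCoprime a q := (gcd_isUnit_iff a q).1 hunit
    set d : ℤ := GCDMonoid.gcd (l j) (s.gcd l) with hd
    have ha0 : a ≠ 0 := fun h => hlj (by rw [ha, h, mul_zero])
    refine ⟨C + d.natAbs * (q.natAbs * a.natAbs), fun A hA => ?_⟩
    obtain ⟨B, hB, hBQ, hBcard⟩ := hC A fun i hi => hA i (Finset.mem_insert_of_mem hi)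
    have hAj := hA j (Finset.mem_insert_self j s)
    refine ⟨(A j).image (a * ·) + B.image (q * ·), ?_, hAj.add_dilates haq hBQ, ?_⟩
    · rw [dilateSum_insert hj, hB, Finset.gcd_insert, ← hd,
        ← AddMonoidHom.coe_mulLeft d, Finset.image_add, Finset.image_image, Finset.image_image]
      congr 1
      · exact Finset.image_congr fun x _ => by simp [ha, mul_assoc]
      · exact Finset.image_congr fun x _ => by
          simp only [Function.comp_apply, AddMonoidHom.coe_mulLeft]
          rw [hq, mul_assoc]
    · have hmain : a.natAbs * (A j).card + q.natAbs * B.card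
          ≤ ((A j).image (a * ·) + B.image (q * ·)).card + q.natAbs * a.natAbs := by
        by_cases hq0 : q = 0
        · subst hq0
          have ha1 : a.natAbs = 1 := Int.isUnit_iff_natAbs_eq.1 (isCoprime_zero_right.1 haq)
          have := Finset.card_le_card_add_right (s := (A j).image (a * ·))
            (hBQ.nonempty.image (0 * ·))
          rw [Finset.card_image_of_injective _ (mul_right_injective₀ ha0)] at this
          simpa [ha1] using this
        · have hqQ : q ∣ Q := by
            rcases s.eq_empty_or_nonempty with rfl | ⟨i, hi⟩
            · rw [Finset.gcd_empty] at hq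
              have hd0 : d ≠ 0 := fun h => hlj (by rw [ha, h, zero_mul])
              exact absurd (mul_eq_zero.1 hq.symm) (by simp [hd0, hq0])
            · exact (Dvd.intro_left d hq.symm).trans ((Finset.gcd_dvd hi).trans
                (hlQ i (Finset.mem_insert_of_mem hi)))
          exact card_add_dilates_ge ha0 hq0 haq (hAj.of_dvd hqQ)
            (hBQ.of_dvd ((Dvd.intro_left d ha.symm).trans hljQ))
      have hlja : (l j).natAbs = d.natAbs * a.natAbs := by rw [← Int.natAbs_mul, ← ha]
      have hgq : (s.gcd l).natAbs = d.natAbs * q.natAbs := by rw [← Int.natAbs_mul, ← hq]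
      rw [Finset.sum_insert hj, Finset.gcd_insert, ← hd, hlja]
      rw [hgq] at hBcard
      nlinarith [Nat.mul_le_mul_left d.natAbs hmain]

/-- The sum of dilates, with coprime coefficients, of sets meeting all classes modulo `Q`. -/
lemma exists_card_dilateSum_ge {ι : Type*} {Q : ℤ} (hQ : Q ≠ 0) (l : ι → ℤ) (s : Finset ι)
    (hl : ∀ i ∈ s, l i ≠ 0) (hlQ : ∀ i ∈ s, l i ∣ Q) (hgcd : s.gcd l = 1) :
    ∃ C : ℕ, ∀ A : ι → Finset ℤ, (∀ i ∈ s, MeetsAllClasses Q (A i)) →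
      ∑ i ∈ s, (l i).natAbs * (A i).card ≤ (dilateSum s l A).card + C := by
  obtain ⟨C, hC⟩ := exists_dilateSum_eq_image hQ l s hl hlQ
  refine ⟨C, fun A hA => ?_⟩
  obtain ⟨B, hB, -, hcard⟩ := hC A hA
  rw [hB]
  simpa [hgcd] using hcard

/-- The residue class of `a` modulo `d` is *full* in `A` if `A` meets all of its subclasses
modulo `d * Q`. -/
def IsFullCell (Q : ℤ) (A : Finset ℤ) (d : ℕ) (a : ℤ) : Prop :=
  ∀ z : ℤ, ∃ x ∈ A, (d : ℤ) * Q ∣ x - (a + d * z)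

lemma intCast_zmod_eq_iff {d : ℕ} {x y : ℤ} : (x : ZMod d) = y ↔ (d : ℤ) ∣ x - y := by
  rw [eq_comm, ZMod.intCast_eq_intCast_iff_dvd_sub]

/-- Summing the dilates of full cells of the same modulus gives a large subset of a single residue
class. -/
lemma sum_natAbs_mul_le_card_filter_dilateSum {ι : Type*} {Q : ℤ} {l : ι → ℤ} {s : Finset ι}
    {C : ℕ} (hC : ∀ A : ι → Finset ℤ, (∀ i ∈ s, MeetsAllClasses Q (A i)) →
      ∑ i ∈ s, (l i).natAbs * (A i).card ≤ (dilateSum s l A).card + C)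
    (A : Finset ℤ) {d : ℕ} (hd : d ≠ 0) (t : ℕ) (a : ι → ℤ)
    (hfull : ∀ i ∈ s, IsFullCell Q A d (a i))
    (ht : ∀ i ∈ s, t ≤ (A.filter fun x : ℤ => (x : ZMod d) = a i).card) :
    (∑ i ∈ s, (l i).natAbs) * t ≤ ((dilateSum s l fun _ => A).filter
      fun x : ℤ => (x : ZMod d) = ∑ i ∈ s, l i • (a i : ZMod d)).card + C := by
  have hd0 : (d : ℤ) ≠ 0 := by exact_mod_cast hd
  let A' : ι → Finset ℤ := fun i =>
    (A.filter fun x : ℤ => (x : ZMod d) = a i).image fun x => (x - a i) / d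
  have hA' : ∀ i, ∀ z ∈ A' i, a i + d * z ∈ A := by
    intro i z hz
    obtain ⟨x, hx, rfl⟩ := Finset.mem_image.1 hz
    obtain ⟨hxA, hxa⟩ := Finset.mem_filter.1 hx
    rw [Int.mul_ediv_cancel' (intCast_zmod_eq_iff.1 hxa)]
    simpa using hxA
  have hcard : ∀ i, (A' i).card = (A.filter fun x : ℤ => (x : ZMod d) = a i).card := by
    intro i
    refine Finset.card_image_of_injOn fun x hx y hy hxy => ?_
    have hx := intCast_zmod_eq_iff.1 (Finset.mem_filter.1 (Finset.mem_coe.1 hx)).2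
    have hy := intCast_zmod_eq_iff.1 (Finset.mem_filter.1 (Finset.mem_coe.1 hy)).2
    have := Int.mul_ediv_cancel' hx
    rw [hxy, Int.mul_ediv_cancel' hy] at this
    linarith
  have hmeets : ∀ i ∈ s, MeetsAllClasses Q (A' i) := by
    intro i hi z
    obtain ⟨x, hx, m, hm⟩ := hfull i hi z
    refine ⟨(x - a i) / d, Finset.mem_image_of_mem _ (Finset.mem_filter.2 ⟨hx,
      intCast_zmod_eq_iff.2 ⟨z + Q * m, by linear_combination hm⟩⟩), m, ?_⟩
    have : x - a i = d * (z + Q * m) := by linear_combination hm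
    rw [this, Int.mul_ediv_cancel_left _ hd0]
    ring
  calc (∑ i ∈ s, (l i).natAbs) * t
      ≤ ∑ i ∈ s, (l i).natAbs * (A' i).card := by
        rw [Finset.sum_mul]
        exact Finset.sum_le_sum fun i hi => Nat.mul_le_mul_left _ (hcard i ▸ ht i hi)
    _ ≤ (dilateSum s l A').card + C := hC A' hmeets
    _ ≤ _ := by
        refine Nat.add_le_add_right (Finset.card_le_card_of_injOn
          (fun z => ∑ i ∈ s, l i • a i + d * z) (fun z hz => ?_) fun x _ y _ h => ?_) C
        · obtain ⟨f, hf, rfl⟩ := mem_dilateSum.1 (Finset.mem_coe.1 hz)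
          refine Finset.mem_coe.2 (Finset.mem_filter.2 ⟨mem_dilateSum.2
            ⟨fun i => a i + d * f i, fun i hi => hA' i _ (hf i hi), ?_⟩, by simp⟩)
          simp only [Finset.mul_sum, smul_eq_mul, mul_add, Finset.sum_add_distrib]
          congr 1
          exact Finset.sum_congr rfl fun i _ => by ring
        · exact mul_left_cancel₀ hd0 (add_left_cancel h)

lemma sum_card_filter_lt_eq {α : Type*} (R : Finset α) (w : α → ℕ) {n : ℕ}
    (hw : ∀ c ∈ R, w c ≤ n) :
    ∑ t ∈ Finset.range n, (R.filter fun c => t < w c).card = ∑ c ∈ R, w c := by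
  simp only [Finset.card_filter]
  rw [Finset.sum_comm]
  refine Finset.sum_congr rfl fun c hc => ?_
  rw [← Finset.card_filter]
  have : (Finset.range n).filter (fun t => t < w c) = Finset.range (w c) := by
    ext t
    simp only [Finset.mem_filter, Finset.mem_range]
    have := hw c hc
    omega
  rw [this, Finset.card_range]

/-- Lower bound for a sum of dilates by the number of elements in full cells. -/
lemma sum_natAbs_mul_card_full_le {ι : Type*} {Q : ℤ} {l : ι → ℤ} {s : Finset ι}
    (hgcd : s.gcd l = 1) {C : ℕ}
    (hC : ∀ A : ι → Finset ℤ, (∀ i ∈ s, MeetsAllClasses Q (A i)) →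
      ∑ i ∈ s, (l i).natAbs * (A i).card ≤ (dilateSum s l A).card + C)
    (A F : Finset ℤ) {d : ℕ} (hd : d ≠ 0) (hFA : F ⊆ A)
    (hF : ∀ a ∈ F, IsFullCell Q A d a) {n : ℕ}
    (hn : (A.image (Int.cast : ℤ → ZMod d)).card ≤ n) :
    (∑ i ∈ s, (l i).natAbs) * F.card
      ≤ (dilateSum s l fun _ => A).card + C * n ^ s.card := by
  classical
  set M := ∑ i ∈ s, (l i).natAbs
  set R : Finset (ZMod d) := F.image Int.cast with hR
  let w : ZMod d → ℕ := fun c => (A.filter fun x : ℤ => (x : ZMod d) = c).card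
  let Rt : ℕ → Finset (ZMod d) := fun t => R.filter fun c => t < w c
  let SR : Finset (ZMod d) := dilateSum s l fun _ => R
  let D : Finset ℤ := dilateSum s l fun _ => A
  have hSub : ∀ t, dilateSum s l (fun _ => Rt t) ⊆ SR := fun t =>
    dilateSum_mono fun _ _ => Finset.filter_subset _ _
  have hFcard : F.card ≤ ∑ c ∈ R, w c := by
    rw [Finset.card_eq_sum_card_fiberwise (f := (Int.cast : ℤ → ZMod d)) (t := R)
      fun x hx => Finset.mem_coe.2 (Finset.mem_image_of_mem _ (Finset.mem_coe.1 hx))]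
    exact Finset.sum_le_sum fun c _ => Finset.card_le_card (Finset.filter_subset_filter _ hFA)
  have hclass : ∀ σ ∈ SR,
      M * ((Finset.range A.card).filter fun t => σ ∈ dilateSum s l fun _ => Rt t).card
        ≤ (D.filter fun x : ℤ => (x : ZMod d) = σ).card + C := by
    intro σ _
    set T := (Finset.range A.card).filter fun t => σ ∈ dilateSum s l fun _ => Rt t with hT
    rcases T.eq_empty_or_nonempty with hTe | hTne
    · simp [hTe]
    have hmem := T.max'_mem hTne
    set m := T.max' hTne with hm
    have hTcard : T.card ≤ m + 1 := by
      rw [← Finset.card_range (m + 1)]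
      exact Finset.card_le_card fun t ht =>
        Finset.mem_range.2 (Nat.lt_succ_of_le (T.le_max' t ht))
    obtain ⟨f, hf, hfσ⟩ := mem_dilateSum.1 (Finset.mem_filter.1 hmem).2
    have hrep : ∀ i, ∃ a : ℤ, i ∈ s → a ∈ F ∧ (a : ZMod d) = f i := fun i => by
      by_cases hi : i ∈ s
      · obtain ⟨a, ha⟩ := Finset.mem_image.1 (Finset.mem_filter.1 (hf i hi)).1
        exact ⟨a, fun _ => ha⟩
      · exact ⟨0, fun h => absurd h hi⟩
    choose a ha using hrep
    have key := sum_natAbs_mul_le_card_filter_dilateSum hC A hd (m + 1) a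
      (fun i hi => hF _ (ha i hi).1)
      (fun i hi => by rw [(ha i hi).2]; exact (Finset.mem_filter.1 (hf i hi)).2)
    have haσ : ∑ i ∈ s, l i • (a i : ZMod d) = σ := by
      rw [← hfσ]
      exact Finset.sum_congr rfl fun i hi => by rw [(ha i hi).2]
    rw [haσ] at key
    exact (Nat.mul_le_mul_left M hTcard).trans key
  have hdouble : ∑ σ ∈ SR,
      ((Finset.range A.card).filter fun t => σ ∈ dilateSum s l fun _ => Rt t).card
        = ∑ t ∈ Finset.range A.card, (dilateSum s l fun _ => Rt t).card := by
    simp only [Finset.card_filter]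
    rw [Finset.sum_comm]
    refine Finset.sum_congr rfl fun t _ => ?_
    rw [← Finset.card_filter, Finset.filter_mem_eq_inter, Finset.inter_eq_right.2 (hSub t)]
  have hSRcard : SR.card ≤ n ^ s.card := (card_dilateSum_le_pow s l R).trans
    (Nat.pow_le_pow_left ((Finset.card_le_card (Finset.image_subset_image hFA)).trans hn) _)
  calc M * F.card ≤ M * ∑ t ∈ Finset.range A.card, (Rt t).card := by
        rw [sum_card_filter_lt_eq R w fun c _ => Finset.card_le_card (Finset.filter_subset _ _)]
        exact Nat.mul_le_mul_left _ hFcard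
    _ ≤ M * ∑ t ∈ Finset.range A.card, (dilateSum s l fun _ => Rt t).card :=
        Nat.mul_le_mul_left _ (Finset.sum_le_sum fun t _ => card_le_card_dilateSum hgcd (Rt t))
    _ ≤ ∑ σ ∈ SR, ((D.filter fun x : ℤ => (x : ZMod d) = σ).card + C) := by
        rw [← hdouble, Finset.mul_sum]
        exact Finset.sum_le_sum hclass
    _ = ∑ σ ∈ SR, (D.filter fun x : ℤ => (x : ZMod d) = σ).card + C * SR.card := by
        rw [Finset.sum_add_distrib, Finset.sum_const, smul_eq_mul, mul_comm C]
    _ ≤ D.card + C * n ^ s.card := by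
        refine Nat.add_le_add ?_ (Nat.mul_le_mul_left _ hSRcard)
        rw [← Finset.card_biUnion fun x _ y _ hxy => ?_]
        · exact Finset.card_le_card (Finset.biUnion_subset.2 fun σ _ => Finset.filter_subset _ _)
        · exact Finset.disjoint_left.2 fun z hz hz' => hxy
            ((Finset.mem_filter.1 hz).2.symm.trans (Finset.mem_filter.1 hz').2)

lemma card_image_le_card_image_of_factors {α β γ : Type*} [DecidableEq β] [DecidableEq γ]
    (B : Finset α) (f : α → β) (h : α → γ)
    (hfh : ∀ x ∈ B, ∀ y ∈ B, f x = f y → h x = h y) :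
    (B.image h).card ≤ (B.image f).card := by
  have hrep : ∀ u : B.image h, ∃ x ∈ B, h x = u := fun u => Finset.mem_image.1 u.2
  choose r hrB hru using hrep
  rw [← Finset.card_attach]
  refine Finset.card_le_card_of_injOn (fun u => f (r u))
    (fun u _ => Finset.mem_coe.2 (Finset.mem_image_of_mem f (hrB u))) fun u _ v _ huv => ?_
  exact Subtype.ext (by rw [← hru u, ← hru v]; exact hfh _ (hrB u) _ (hrB v) huv)

lemma card_image_zmod_mul_le (B : Finset ℤ) {g Q : ℕ} (hQ : Q ≠ 0) :
    (B.image (Int.cast : ℤ → ZMod (g * Q))).card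
      ≤ Q * (B.image (Int.cast : ℤ → ZMod g)).card := by
  have : NeZero Q := ⟨hQ⟩
  calc (B.image (Int.cast : ℤ → ZMod (g * Q))).card
      ≤ (B.image fun x : ℤ => (((x / g : ℤ) : ZMod Q), (x : ZMod g))).card := by
        refine card_image_le_card_image_of_factors B _ _ fun x _ y _ hxy => ?_
        obtain ⟨h1, h2⟩ := Prod.mk.inj hxy
        obtain ⟨m, hm⟩ := intCast_zmod_eq_iff.1 h1
        have h3 : x % g = y % g := (ZMod.intCast_eq_intCast_iff' x y g).1 h2
        refine intCast_zmod_eq_iff.2 ⟨m, ?_⟩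
        push_cast
        linear_combination (g : ℤ) * hm + h3 - Int.emod_add_mul_ediv x g
          + Int.emod_add_mul_ediv y g
    _ ≤ ((Finset.univ : Finset (ZMod Q)) ×ˢ B.image (Int.cast : ℤ → ZMod g)).card := by
        refine Finset.card_le_card (Finset.image_subset_iff.2 fun x hx => ?_)
        exact Finset.mem_product.2 ⟨Finset.mem_univ _, Finset.mem_image_of_mem _ hx⟩
    _ = Q * (B.image (Int.cast : ℤ → ZMod g)).card := by
        rw [Finset.card_product, Finset.card_univ, ZMod.card]

/-- The differences of elements of `A` that are divisible by `d`. -/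
def divDiff (A : Finset ℤ) (d : ℕ) : Finset ℤ :=
  (A - A).filter fun y => (d : ℤ) ∣ y

lemma sub_mem_divDiff {A : Finset ℤ} {d : ℕ} {x y : ℤ} (hx : x ∈ A) (hy : y ∈ A)
    (h : (d : ℤ) ∣ x - y) : x - y ∈ divDiff A d :=
  Finset.mem_filter.2 ⟨Finset.sub_mem_sub hx hy, h⟩

lemma dvd_of_mem_divDiff {A : Finset ℤ} {d : ℕ} {y : ℤ} (h : y ∈ divDiff A d) : (d : ℤ) ∣ y :=
  (Finset.mem_filter.1 h).2

lemma neg_mem_divDiff {A : Finset ℤ} {d : ℕ} {y : ℤ} (h : y ∈ divDiff A d) :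
    -y ∈ divDiff A d := by
  obtain ⟨h1, h2⟩ := Finset.mem_filter.1 h
  obtain ⟨u, hu, v, hv, rfl⟩ := Finset.mem_sub.1 h1
  exact Finset.mem_filter.2 ⟨by rw [neg_sub]; exact Finset.sub_mem_sub hv hu, h2.neg_right⟩

lemma divDiff_subset_of_dvd (A : Finset ℤ) {d e : ℕ} (h : d ∣ e) :
    divDiff A e ⊆ divDiff A d := fun _ hy =>
  Finset.mem_filter.2 ⟨(Finset.mem_filter.1 hy).1,
    (Int.natCast_dvd_natCast.2 h).trans (Finset.mem_filter.1 hy).2⟩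

/-- The enlargement `A + Y + Y` of `A`, with `Y` the differences divisible by `d`. -/
def thicken (A : Finset ℤ) (d : ℕ) : Finset ℤ :=
  A + (divDiff A d + divDiff A d)

/-- In a residue class that is not full, translation by a suitable difference leads to a subclass
which `A` does not meet. -/
lemma exists_add_not_congr {A : Finset ℤ} {g Q : ℕ}
    (hgen : AddSubgroup.closure (divDiff A g : Set ℤ) = AddSubgroup.zmultiples (g : ℤ))
    {a : ℤ} (ha : a ∈ A) (hfull : ¬ IsFullCell Q A g a) :
    ∃ x ∈ A, ∃ y ∈ divDiff A g, (g : ℤ) ∣ x + y - a ∧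
      ∀ b ∈ A, ¬ (g : ℤ) * Q ∣ b - (x + y) := by
  by_contra! hcon
  have hstep : ∀ h : ℤ, (g : ℤ) ∣ h → (∃ b ∈ A, (g : ℤ) * Q ∣ b - (a + h)) →
      ∀ y ∈ divDiff A g, ∃ b ∈ A, (g : ℤ) * Q ∣ b - (a + (y + h)) := by
    rintro h hgh ⟨x, hx, hxh⟩ y hy
    have hxa : (g : ℤ) ∣ x + y - a := by
      have h1 := ((Dvd.intro _ rfl).trans hxh : (g : ℤ) ∣ x - (a + h))
      have h2 := dvd_add (dvd_add h1 hgh) (dvd_of_mem_divDiff hy)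
      ring_nf at h2 ⊢
      exact h2
    obtain ⟨b, hb, hbx⟩ := hcon x hx y hy hxa
    refine ⟨b, hb, ?_⟩
    have h3 := dvd_add hbx hxh
    ring_nf at h3 ⊢
    exact h3
  have hclosure : ∀ h ∈ AddSubgroup.closure (divDiff A g : Set ℤ),
      ∃ b ∈ A, (g : ℤ) * Q ∣ b - (a + h) := by
    have hdvd : ∀ h ∈ AddSubgroup.closure (divDiff A g : Set ℤ), (g : ℤ) ∣ h := fun h hh =>
      Int.mem_zmultiples_iff.1 (hgen ▸ hh)
    intro h hh
    induction hh using AddSubgroup.closure_induction_left with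
    | zero => exact ⟨a, ha, by simp⟩
    | add_left y hy h hh ih => exact hstep h (hdvd h hh) ih y hy
    | neg_add_cancel y hy h hh ih =>
      exact hstep h (hdvd h hh) ih (-y) (neg_mem_divDiff hy)
  exact hfull fun z => hclosure _ (by
    rw [hgen]; exact Int.mem_zmultiples_iff.2 (Dvd.intro z rfl))

/-- Passing from the modulus `g` to `g * Q` decreases the thickening of `A` at least in proportion
to the number of elements of `A` in cells that are not full. -/
lemma card_thicken_mul_add_le {A : Finset ℤ} {g Q : ℕ} (hQ : Q ≠ 0)
    (hgen : AddSubgroup.closure (divDiff A g : Set ℤ) = AddSubgroup.zmultiples (g : ℤ))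
    {B : Finset ℤ} (hBA : B ⊆ A) (hB : ∀ a ∈ B, ¬ IsFullCell Q A g a) :
    Q * (thicken A (g * Q)).card + B.card ≤ Q * (thicken A g).card := by
  classical
  set Y := divDiff A (g * Q) with hY
  have hYg : Y ⊆ divDiff A g := divDiff_subset_of_dvd A (Dvd.intro Q rfl)
  have hYdvd : ∀ y ∈ Y, (g : ℤ) * Q ∣ y := fun y hy => by
    have := dvd_of_mem_divDiff hy
    push_cast at this
    exact this
  set cells := B.image (Int.cast : ℤ → ZMod g) with hcells
  have hBcard : B.card ≤ Q * (cells.card * Y.card) := by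
    calc B.card ≤ Y.card * (B.image (Int.cast : ℤ → ZMod (g * Q))).card := by
          refine Finset.card_le_mul_card_image B Y.card fun c hc => ?_
          obtain ⟨b, hb, rfl⟩ := Finset.mem_image.1 hc
          refine Finset.card_le_card_of_injOn (fun x => x - b) (fun x hx => ?_)
            fun x _ y _ h => sub_left_injective h
          obtain ⟨hx, hxb⟩ := Finset.mem_filter.1 (Finset.mem_coe.1 hx)
          exact Finset.mem_coe.2 (sub_mem_divDiff (hBA hx) (hBA hb) (intCast_zmod_eq_iff.1 hxb))
      _ ≤ Y.card * (Q * cells.card) := Nat.mul_le_mul_left _ (card_image_zmod_mul_le B hQ)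
      _ = Q * (cells.card * Y.card) := by ring
  have hrep : ∀ c : cells, ∃ z : ℤ, (z : ZMod g) = c ∧
      (∃ x ∈ A, ∃ y ∈ divDiff A g, x + y = z) ∧ ∀ b ∈ A, ¬ (g : ℤ) * Q ∣ b - z := by
    rintro ⟨c, hc⟩
    obtain ⟨a, ha, rfl⟩ := Finset.mem_image.1 hc
    obtain ⟨x, hx, y, hy, hxy, hno⟩ := exists_add_not_congr hgen (hBA ha) (hB a ha)
    exact ⟨x + y, intCast_zmod_eq_iff.2 hxy, ⟨x, hx, y, hy, rfl⟩, hno⟩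
  choose z hzc hzA hzno using hrep
  have hgain : cells.card * Y.card ≤ (thicken A g \ thicken A (g * Q)).card := by
    rw [← Finset.card_attach, ← Finset.card_product]
    refine Finset.card_le_card_of_injOn (fun e => z e.1 + e.2) (fun e he => ?_) ?_
    · have hy := (Finset.mem_product.1 (Finset.mem_coe.1 he)).2
      refine Finset.mem_coe.2 (Finset.mem_sdiff.2 ⟨?_, fun hmem => ?_⟩)
      · obtain ⟨x, hx, y, hy', hxy⟩ := hzA e.1
        simp only
        rw [← hxy, add_assoc]
        exact Finset.add_mem_add hx (Finset.add_mem_add hy' (hYg hy))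
      · obtain ⟨b, hb, _, hu, h⟩ := Finset.mem_add.1 hmem
        obtain ⟨y₁, hy₁, y₂, hy₂, rfl⟩ := Finset.mem_add.1 hu
        refine hzno e.1 b hb ?_
        have : b - z e.1 = e.2 - y₁ - y₂ := by linear_combination h
        rw [this]
        exact dvd_sub (dvd_sub (hYdvd _ hy) (hYdvd _ hy₁)) (hYdvd _ hy₂)
    · rintro ⟨c, y⟩ hy ⟨c', y'⟩ hy' h
      have hy := hYdvd _ (Finset.mem_product.1 (Finset.mem_coe.1 hy)).2
      have hy' := hYdvd _ (Finset.mem_product.1 (Finset.mem_coe.1 hy')).2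
      simp only at h hy hy'
      have hzz : (g : ℤ) ∣ z c - z c' := by
        have : z c - z c' = y' - y := by linear_combination h
        rw [this]
        exact (Dvd.intro _ rfl).trans (dvd_sub hy' hy)
      have hcc : c = c' := Subtype.ext (by
        rw [← hzc c, ← hzc c']; exact intCast_zmod_eq_iff.2 hzz)
      subst hcc
      simpa using h
  have hsub : thicken A (g * Q) ⊆ thicken A g :=
    Finset.add_subset_add_left (Finset.add_subset_add hYg hYg)
  have hsdiff := Finset.card_sdiff_add_card_eq_card hsub
  nlinarith [Nat.mul_le_mul_left Q hgain]

/-- If two elements of `A` are congruent modulo `d`, the modulus can be replaced by the generator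
of the group generated by the differences divisible by `d`. -/
lemma exists_normalized_modulus {A : Finset ℤ} {d : ℕ}
    (hlt : (A.image (Int.cast : ℤ → ZMod d)).card < A.card) :
    ∃ g : ℕ, g ≠ 0 ∧
      AddSubgroup.closure (divDiff A g : Set ℤ) = AddSubgroup.zmultiples (g : ℤ) ∧
      divDiff A g = divDiff A d ∧
      (A.image (Int.cast : ℤ → ZMod g)).card ≤ (A.image (Int.cast : ℤ → ZMod d)).card := by
  obtain ⟨x, hx, y, hy, hxy, hcast⟩ := Finset.exists_ne_map_eq_of_card_lt_of_maps_to hlt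
    (f := (Int.cast : ℤ → ZMod d)) fun x hx => Finset.mem_image_of_mem _ hx
  obtain ⟨m, hm⟩ := Int.subgroup_cyclic (AddSubgroup.closure (divDiff A d : Set ℤ))
  have hcl : AddSubgroup.closure (divDiff A d : Set ℤ)
      = AddSubgroup.zmultiples (m.natAbs : ℤ) := by
    rw [hm, ← AddSubgroup.zmultiples_eq_closure, Int.zmultiples_natAbs]
  have hdvd : ∀ w ∈ divDiff A d, (m.natAbs : ℤ) ∣ w := fun w hw =>
    Int.mem_zmultiples_iff.1 (hcl ▸ AddSubgroup.subset_closure hw)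
  have hdm : d ∣ m.natAbs := by
    have hle : AddSubgroup.closure (divDiff A d : Set ℤ) ≤ AddSubgroup.zmultiples (d : ℤ) :=
      (AddSubgroup.closure_le _).2 fun w hw =>
        Int.mem_zmultiples_iff.2 (dvd_of_mem_divDiff hw)
    rw [hcl] at hle
    exact Int.natCast_dvd_natCast.1
      (Int.mem_zmultiples_iff.1 (hle (AddSubgroup.mem_zmultiples _)))
  have heq : divDiff A m.natAbs = divDiff A d :=
    (divDiff_subset_of_dvd A hdm).antisymm fun w hw =>
      Finset.mem_filter.2 ⟨(Finset.mem_filter.1 hw).1, hdvd w hw⟩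
  refine ⟨m.natAbs, fun h0 => hxy ?_, by rw [heq, hcl], heq,
    card_image_le_card_image_of_factors A _ _ fun u hu v hv huv =>
      intCast_zmod_eq_iff.2 (hdvd _ (sub_mem_divDiff hu hv (intCast_zmod_eq_iff.1 huv)))⟩
  have := hdvd _ (sub_mem_divDiff hx hy (intCast_zmod_eq_iff.1 hcast))
  rw [h0, Nat.cast_zero, zero_dvd_iff] at this
  exact sub_eq_zero.1 this

open Classical in
/-- Either some modulus with few cells has few elements outside full cells, or there is a
modulus with few cells for which the thickening of `A` is small. -/
lemma exists_few_not_full_or_small_thicken {Q : ℕ} (hQ : Q ≠ 0) (A : Finset ℤ) (b t : ℕ)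
    (ht : Q ^ t < A.card) :
    (∃ d : ℕ, d ≠ 0 ∧ (A.image (Int.cast : ℤ → ZMod d)).card ≤ Q ^ t ∧
      (A.filter fun a => ¬ IsFullCell Q A d a).card ≤ b) ∨
    ∃ d : ℕ, (A.image (Int.cast : ℤ → ZMod d)).card ≤ Q ^ t ∧
      Q * (thicken A d).card + t * (b + 1) ≤ Q * (thicken A 1).card := by
  induction t with
  | zero =>
    refine Or.inr ⟨1, ?_, by simp⟩
    rw [pow_zero]
    exact Finset.card_le_one.2 fun x _ y _ => Subsingleton.elim _ _
  | succ t ih =>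
    have hmono : Q ^ t ≤ Q ^ (t + 1) := Nat.pow_le_pow_right (Nat.pos_of_ne_zero hQ) t.le_succ
    rcases ih (hmono.trans_lt ht) with ⟨d, hd, hcells, hb⟩ | ⟨d, hcells, hE⟩
    · exact Or.inl ⟨d, hd, hcells.trans hmono, hb⟩
    obtain ⟨g, hg, hgen, hgd, hgcells⟩ :=
      exists_normalized_modulus (hcells.trans_lt (hmono.trans_lt ht))
    by_cases hb : (A.filter fun a => ¬ IsFullCell Q A g a).card ≤ b
    · exact Or.inl ⟨g, hg, (hgcells.trans hcells).trans hmono, hb⟩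
    · refine Or.inr ⟨g * Q, ?_, ?_⟩
      · rw [pow_succ']
        exact (card_image_zmod_mul_le A hQ).trans
          (Nat.mul_le_mul_left Q (hgcells.trans hcells))
      · have hgain := card_thicken_mul_add_le hQ hgen (Finset.filter_subset _ A)
          fun a ha => (Finset.mem_filter.1 ha).2
        have hthick : thicken A g = thicken A d := by rw [thicken, thicken, hgd]
        rw [hthick] at hgain
        nlinarith

/-- A set with a small sum of at least two dilates has a small thickening. -/
lemma card_thicken_one_le {ι : Type*} {l : ι → ℤ} {s : Finset ι} {i j : ι} (hi : i ∈ s)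
    (hj : j ∈ s) (hij : i ≠ j) (hli : l i ≠ 0) (hlj : l j ≠ 0) {A : Finset ℤ} {M : ℕ}
    (hM : (dilateSum s l fun _ => A).card ≤ M * A.card) :
    (thicken A 1).card ≤ M ^ 5 * A.card := by
  classical
  rcases A.eq_empty_or_nonempty with rfl | hA
  · simp [thicken]
  set X := A.image fun a => l i • a with hX
  set B := A.image fun a => l j • a with hB
  have hXcard : X.card = A.card := Finset.card_image_of_injective _ (smul_right_injective ℤ hli)
  have hXB : (X + B).card ≤ M * A.card := by
    have hsplit : dilateSum s l (fun _ => A)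
        = X + B + dilateSum ((s.erase i).erase j) l fun _ => A := by
      have hj' : j ∈ s.erase i := Finset.mem_erase.2 ⟨hij.symm, hj⟩
      conv_lhs => rw [← Finset.insert_erase hi, ← Finset.insert_erase hj']
      rw [dilateSum_insert (by simp [hij]), dilateSum_insert (by simp), add_assoc]
    have hne : (dilateSum ((s.erase i).erase j) l fun _ => A).Nonempty :=
      ⟨_, mem_dilateSum.2 ⟨fun _ => hA.choose, fun _ _ => hA.choose_spec, rfl⟩⟩
    rw [hsplit] at hM
    exact (Finset.card_le_card_add_right hne).trans hM
  have hpr := Finset.pluennecke_ruzsa_inequality_nsmul_sub_nsmul_add (hA.image fun a => l i • a)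
    B 3 2
  rw [← hX, hXcard] at hpr
  have hApos : (0 : ℚ≥0) < A.card := by exact_mod_cast hA.card_pos
  have hratio : ((X + B).card / A.card : ℚ≥0) ≤ M := by
    rw [div_le_iff₀ hApos]
    exact_mod_cast hXB
  have hbound : (3 • B - 2 • B).card ≤ M ^ 5 * A.card := by
    have : ((3 • B - 2 • B).card : ℚ≥0) ≤ (M : ℚ≥0) ^ 5 * A.card := hpr.trans (by gcongr)
    exact_mod_cast this
  refine le_trans ?_ hbound
  refine Finset.card_le_card_of_injOn (fun x => l j • x) (fun x hx => ?_)
    fun x _ y _ h => smul_right_injective ℤ hlj h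
  obtain ⟨a, ha, _, hu, rfl⟩ := Finset.mem_add.1 (Finset.mem_coe.1 hx)
  obtain ⟨y, hy, y', hy', rfl⟩ := Finset.mem_add.1 hu
  obtain ⟨b, hb, c, hc, rfl⟩ := Finset.mem_sub.1 (Finset.mem_filter.1 hy).1
  obtain ⟨b', hb', c', hc', rfl⟩ := Finset.mem_sub.1 (Finset.mem_filter.1 hy').1
  have hmem : ∀ x ∈ A, l j • x ∈ B := fun x hx => Finset.mem_image_of_mem _ hx
  have h3 : l j • a + l j • b + l j • b' ∈ 3 • B := by
    rw [succ_nsmul, two_nsmul]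
    exact Finset.add_mem_add (Finset.add_mem_add (hmem a ha) (hmem b hb)) (hmem b' hb')
  have h2 : l j • c + l j • c' ∈ 2 • B := by
    rw [two_nsmul]
    exact Finset.add_mem_add (hmem c hc) (hmem c' hc')
  have heq : l j • (a + (b - c + (b' - c')))
      = l j • a + l j • b + l j • b' - (l j • c + l j • c') := by
    simp only [smul_eq_mul]
    ring
  simp only [heq]
  exact Finset.mem_coe.2 (Finset.sub_mem_sub h3 h2)

/-- Asymptotically sharp lower bound for sums of dilates of finite sets of integers. -/
theorem exists_card_dilateSum_int_ge {ι : Type*} {l : ι → ℤ} {s : Finset ι}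
    (hl : ∀ i ∈ s, l i ≠ 0) (hgcd : s.gcd l = 1) {ε : ℝ} (hε : 0 < ε) :
    ∃ N : ℕ, ∀ A : Finset ℤ, N ≤ A.card →
      (((∑ i ∈ s, (l i).natAbs : ℕ) : ℝ) - ε) * A.card
        ≤ ((dilateSum s l fun _ => A).card : ℝ) := by
  classical
  set M := ∑ i ∈ s, (l i).natAbs with hMdef
  have hsne : s.Nonempty := by
    rw [Finset.nonempty_iff_ne_empty]
    rintro rfl
    simp at hgcd
  by_cases hsub : ∃ i ∈ s, ∃ j ∈ s, i ≠ j
  swap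
  · obtain ⟨i, hi⟩ := hsne
    push Not at hsub
    have hs : s = {i} := Finset.eq_singleton_iff_unique_mem.2 ⟨hi, fun j hj => hsub j hj i hi⟩
    refine ⟨0, fun A _ => ?_⟩
    have hM1 : M = 1 := by
      rw [hMdef, hs, Finset.sum_singleton]
      rw [hs, Finset.gcd_singleton, ← Int.abs_eq_normalize, Int.abs_eq_natAbs] at hgcd
      exact_mod_cast hgcd
    have hcard : (A.card : ℝ) ≤ (dilateSum s l fun _ => A).card := by
      exact_mod_cast card_le_card_dilateSum hgcd A
    rw [hM1, Nat.cast_one]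
    nlinarith [(Nat.cast_nonneg A.card : (0 : ℝ) ≤ A.card)]
  obtain ⟨i, hi, j, hj, hij⟩ := hsub
  have hMpos : 0 < (M : ℝ) := by
    have : (l i).natAbs ≤ M :=
      Finset.single_le_sum (f := fun i => (l i).natAbs) (fun _ _ => Nat.zero_le _) hi
    exact_mod_cast (Int.natAbs_pos.2 (hl i hi)).trans_le this
  set Q : ℕ := ∏ i ∈ s, (l i).natAbs with hQdef
  have hQ : Q ≠ 0 := Finset.prod_ne_zero_iff.2 fun i hi => Int.natAbs_ne_zero.2 (hl i hi)
  have hlQ : ∀ i ∈ s, l i ∣ (Q : ℤ) := fun i hi =>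
    Int.natAbs_dvd.1 (Int.natCast_dvd_natCast.2 (Finset.dvd_prod_of_mem _ hi))
  obtain ⟨C, hC⟩ := exists_card_dilateSum_ge (by exact_mod_cast hQ) l s hl hlQ hgcd
  set β : ℝ := ε / (2 * M) with hβ
  have hβpos : 0 < β := by positivity
  obtain ⟨t, ht⟩ := exists_nat_gt ((Q : ℝ) * M ^ 5 / β)
  obtain ⟨N, hN⟩ := exists_nat_ge ((C : ℝ) * (Q ^ t : ℕ) ^ s.card / (ε / 2))
  refine ⟨max (Q ^ t + 1) N, fun A hA => ?_⟩
  have hA1 : Q ^ t < A.card := (le_max_left _ _).trans hA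
  have hA2 : (C : ℝ) * (Q ^ t : ℕ) ^ s.card ≤ ε / 2 * A.card := by
    have : (N : ℝ) ≤ A.card := by exact_mod_cast (le_max_right _ _).trans hA
    rw [div_le_iff₀ (by positivity)] at hN
    nlinarith
  have hApos : (0 : ℝ) < A.card := by exact_mod_cast (Nat.zero_le _).trans_lt hA1
  by_cases hbig : (dilateSum s l fun _ => A).card ≤ M * A.card
  swap
  · have : (M : ℝ) * A.card ≤ (dilateSum s l fun _ => A).card := by
      exact_mod_cast (not_le.1 hbig).le
    nlinarith
  have hthick := card_thicken_one_le hi hj hij (hl i hi) (hl j hj) hbig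
  rcases exists_few_not_full_or_small_thicken hQ A ⌊β * A.card⌋₊ t hA1 with
    ⟨d, hd, hcells, hb⟩ | ⟨d, -, hE⟩
  · have hmain := sum_natAbs_mul_card_full_le hgcd hC A
      (A.filter fun a => IsFullCell Q A d a) hd (Finset.filter_subset _ _)
      (fun a ha => (Finset.mem_filter.1 ha).2) hcells
    have hsplit := Finset.card_filter_add_card_filter_not (s := A) (fun a => IsFullCell Q A d a)
    have hb' : ((A.filter fun a => ¬ IsFullCell Q A d a).card : ℝ) ≤ β * A.card :=
      (Nat.cast_le.2 hb).trans (Nat.floor_le (by positivity))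
    have hmain' : (M : ℝ) * (A.filter fun a => IsFullCell Q A d a).card
        ≤ (dilateSum s l fun _ => A).card + C * (Q ^ t : ℕ) ^ s.card := by
      exact_mod_cast hmain
    have hsplit' : ((A.filter fun a => IsFullCell Q A d a).card : ℝ)
        + (A.filter fun a => ¬ IsFullCell Q A d a).card = A.card := by
      exact_mod_cast hsplit
    have hMβ : (M : ℝ) * β = ε / 2 := by
      rw [hβ]
      field_simp
    have hlow : (M : ℝ) * (A.card - β * A.card)
        ≤ M * (A.filter fun a => IsFullCell Q A d a).card :=
      mul_le_mul_of_nonneg_left (by linarith) hMpos.le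
    have hexp : (M : ℝ) * (A.card - β * A.card) = M * A.card - ε / 2 * A.card := by
      rw [← hMβ]
      ring
    linarith
  · exfalso
    have h1 : t * (⌊β * A.card⌋₊ + 1) ≤ Q * (M ^ 5 * A.card) :=
      ((Nat.le_add_left _ _).trans hE).trans (Nat.mul_le_mul_left Q hthick)
    have h2 : (t : ℝ) * (⌊β * A.card⌋₊ + 1) ≤ Q * (M ^ 5 * A.card) := by exact_mod_cast h1
    have h3 : (t : ℝ) * (β * A.card) ≤ t * (⌊β * A.card⌋₊ + 1) :=
      mul_le_mul_of_nonneg_left (Nat.lt_floor_add_one _).le (Nat.cast_nonneg t)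
    rw [div_lt_iff₀ hβpos] at ht
    nlinarith [mul_lt_mul_of_pos_right ht hApos]

lemma exists_progression_of_apDiameter {p : ℕ} [NeZero p] (A : Finset (ZMod p)) :
    ∃ x d : ZMod p, ∀ a ∈ A, ∃ j : ℕ, j < apDiameter A ∧ a = x + j • d := by
  refine Nat.sInf_mem (s := {l : ℕ | ∃ x d : ZMod p, ∀ a ∈ A, ∃ j : ℕ, j < l ∧ a = x + j • d})
    ⟨p, 0, 1, fun a _ => ⟨a.val, a.val_lt, ?_⟩⟩
  simp

/-- A subset of `ℤ/pℤ` of small diameter has an integer model whose sum of dilates is not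
larger. -/
lemma exists_int_model_s3 {ι : Type*} (l : ι → ℤ) (s : Finset ι) {p : ℕ} (hp : p.Prime)
    {A : Finset (ZMod p)} (hcard : 1 < A.card)
    (hdiam : (∑ i ∈ s, (l i).natAbs) * apDiameter A < p) :
    ∃ B : Finset ℤ, A.card ≤ B.card ∧
      (dilateSum s l fun _ => B).card ≤ (dilateSum s l fun _ => A).card := by
  classical
  have : Fact p.Prime := ⟨hp⟩
  obtain ⟨x, d, hxd⟩ := exists_progression_of_apDiameter A
  set L := apDiameter A with hL
  have hd : d ≠ 0 := by
    rintro rfl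
    refine hcard.not_ge (Finset.card_le_one.2 fun a ha b hb => ?_)
    obtain ⟨_, -, rfl⟩ := hxd a ha
    obtain ⟨_, -, rfl⟩ := hxd b hb
    simp
  let B : Finset ℤ := (Finset.Ico (0 : ℤ) L).filter fun n => x + n • d ∈ A
  have hBA : ∀ n ∈ B, x + n • d ∈ A := fun n hn => (Finset.mem_filter.1 hn).2
  have hBL : ∀ n ∈ B, 0 ≤ n ∧ n < L := fun n hn =>
    Finset.mem_Ico.1 (Finset.mem_filter.1 hn).1
  refine ⟨B, ?_, ?_⟩
  · have hsub : A ⊆ B.image fun n => x + n • d := by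
      intro a ha
      obtain ⟨j, hj, rfl⟩ := hxd a ha
      exact Finset.mem_image.2 ⟨j, Finset.mem_filter.2
        ⟨Finset.mem_Ico.2 ⟨by positivity, by exact_mod_cast hj⟩, by simpa using ha⟩, by simp⟩
    exact (Finset.card_le_card hsub).trans Finset.card_image_le
  · refine Finset.card_le_card_of_injOn (fun n => ∑ i ∈ s, l i • x + n • d)
      (fun n hn => ?_) fun n hn m hm h => ?_
    · obtain ⟨f, hf, rfl⟩ := mem_dilateSum.1 (Finset.mem_coe.1 hn)
      refine Finset.mem_coe.2 (mem_dilateSum.2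
        ⟨fun i => x + f i • d, fun i hi => hBA _ (hf i hi), ?_⟩)
      simp only [smul_add, Finset.sum_add_distrib, Finset.sum_smul, smul_eq_mul, mul_smul]
    · obtain ⟨f, hf, rfl⟩ := mem_dilateSum.1 (Finset.mem_coe.1 hn)
      obtain ⟨f', hf', rfl⟩ := mem_dilateSum.1 (Finset.mem_coe.1 hm)
      have h1 : (∑ i ∈ s, l i • f i - ∑ i ∈ s, l i • f' i) • d = 0 := by
        rw [sub_smul, sub_eq_zero]
        exact add_left_cancel h
      have h2 : (p : ℤ) ∣ ∑ i ∈ s, l i • f i - ∑ i ∈ s, l i • f' i := by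
        rw [zsmul_eq_mul, mul_eq_zero, or_iff_left hd] at h1
        exact (ZMod.intCast_zmod_eq_zero_iff_dvd _ p).1 h1
      have h3 : |∑ i ∈ s, l i • f i - ∑ i ∈ s, l i • f' i| < p := by
        calc |∑ i ∈ s, l i • f i - ∑ i ∈ s, l i • f' i|
            = |∑ i ∈ s, l i * (f i - f' i)| := by
              rw [← Finset.sum_sub_distrib]
              simp only [smul_eq_mul, mul_sub]
          _ ≤ ∑ i ∈ s, |l i * (f i - f' i)| := Finset.abs_sum_le_sum_abs _ _
          _ ≤ ∑ i ∈ s, |l i| * L := Finset.sum_le_sum fun i hi => by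
              rw [abs_mul]
              refine mul_le_mul_of_nonneg_left (abs_le.2 ?_) (abs_nonneg _)
              have := hBL _ (hf i hi)
              have := hBL _ (hf' i hi)
              constructor <;> linarith
          _ = (((∑ i ∈ s, (l i).natAbs) * L : ℕ) : ℤ) := by
              rw [← Finset.sum_mul]
              push_cast
              rfl
          _ < p := by exact_mod_cast hdiam
      exact sub_eq_zero.1 (Int.eq_zero_of_abs_lt_dvd h2 h3)

theorem sums_of_dilates_small_diameter (k : ℕ) (hk : 1 ≤ k) (l : Fin k → ℤ)
    (hl : ∀ i, l i ≠ 0) (hgcd : Finset.univ.gcd l = 1)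
    (M : ℕ) (hM : (M : ℤ) = ∑ i, |l i|)
    (ε : ℝ) (hε : 0 < ε) :
    ∃ N : ℕ, ∀ p : ℕ, p.Prime →
      ∀ A : Finset (ZMod p), (apDiameter A : ℝ) < (p : ℝ) / M → N ≤ A.card →
        ((M : ℝ) - ε) * A.card ≤ ((∑ i, A.image fun a => l i • a).card : ℝ) := by
  have hMsum : M = ∑ i, (l i).natAbs := by
    zify
    exact hM
  have hMpos : 0 < M := by
    rw [hMsum]
    exact Finset.sum_pos (fun i _ => Int.natAbs_pos.2 (hl i)) ⟨⟨0, hk⟩, Finset.mem_univ _⟩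
  obtain ⟨N, hN⟩ := exists_card_dilateSum_int_ge (fun i _ => hl i) hgcd hε
  rw [← hMsum] at hN
  refine ⟨max N 2, fun p hp A hdiam hA => ?_⟩
  have hdiam' : (∑ i, (l i).natAbs) * apDiameter A < p := by
    rw [lt_div_iff₀ (by exact_mod_cast hMpos), mul_comm] at hdiam
    rw [← hMsum]
    exact_mod_cast hdiam
  obtain ⟨B, hAB, hBA⟩ := exists_int_model_s3 l Finset.univ hp
    (lt_of_lt_of_le one_lt_two ((le_max_right _ _).trans hA)) hdiam'
  change ((M : ℝ) - ε) * A.card ≤ ((dilateSum Finset.univ l fun _ => A).card : ℝ)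
  have hB := hN B (((le_max_left _ _).trans hA).trans hAB)
  have hAB' : (A.card : ℝ) ≤ B.card := by exact_mod_cast hAB
  have hBA' : ((dilateSum Finset.univ l fun _ => B).card : ℝ)
      ≤ (dilateSum Finset.univ l fun _ => A).card := by exact_mod_cast hBA
  rcases le_total 0 ((M : ℝ) - ε) with h | h
  · exact (mul_le_mul_of_nonneg_left hAB' h).trans (hB.trans hBA')
  · exact (mul_nonpos_of_nonpos_of_nonneg h (Nat.cast_nonneg _)).trans (Nat.cast_nonneg _)
end
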